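/- arXiv:2106.07736 — 2 statements merged into one kernel-verified Lean document; each statement's English description precedes it below -/
import Mathlib

section
/- There exists an absolute constant C > 0 with the following property. Assume 0 < θ ≤ 1/9, C⋆ ≥ 1/5, and suppose sup over unit q of ‖grad F(q) − grad f(q)‖₂ ≤ δ₁ with δ₁ ≤ 5×10⁻⁵ and sup over unit q of ‖Hess F(q) − Hess f(q)‖_op ≤ δ₂ with δ₂ ≤ 10⁻³. Then every unit vector q̄ ∈ ℝ^p with ‖Aᵀq̄‖_∞² ≥ C⋆ that satisfies grad F(q̄) = 0 and vᵀ Hess F(q̄) v ≥ 0 for all v ⊥ q̄ obeys min over i ∈ {1,…,r} and s ∈ {+1,−1} of ‖q̄ − s·a_i‖₂² ≤ C·δ₁. -/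
open Matrix MeasureTheory ProbabilityTheory Real
open scoped BigOperators ENNReal

noncomputable section

/-- squared Euclidean norm -/
def l2sq {m : ℕ} (v : Fin m → ℝ) : ℝ := ∑ i, v i ^ 2

/-- fourth power of the ℓ₄ norm -/
def l4p4 {m : ℕ} (v : Fin m → ℝ) : ℝ := ∑ i, v i ^ 4

/-- Euclidean norm -/
def l2norm {m : ℕ} (v : Fin m → ℝ) : ℝ := Real.sqrt (l2sq v)

/-- squared sup-norm -/
def linfSq {m : ℕ} (v : Fin m → ℝ) : ℝ := ⨆ i, (v i) ^ 2

/-- projection onto the orthogonal complement of q -/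
def proj {p : ℕ} (q : Fin p → ℝ) : Matrix (Fin p) (Fin p) ℝ := 1 - Matrix.vecMulVec q q

def zeta {p r : ℕ} (A : Matrix (Fin p) (Fin r) ℝ) (q : Fin p → ℝ) : Fin r → ℝ := Aᵀ *ᵥ q

/-- population objective -/
def fpop {p r : ℕ} (θ : ℝ) (A : Matrix (Fin p) (Fin r) ℝ) (q : Fin p → ℝ) : ℝ :=
  -(1/4) * ((1 - θ) * l4p4 (zeta A q) + θ * (l2sq (zeta A q)) ^ 2)

/-- Riemannian gradient of the population objective -/
def gradf {p r : ℕ} (θ : ℝ) (A : Matrix (Fin p) (Fin r) ℝ) (q : Fin p → ℝ) : Fin p → ℝ :=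
  -((proj q) *ᵥ ((1 - θ) • (A *ᵥ fun j => (zeta A q j) ^ 3)
      + (θ * l2sq (zeta A q)) • (A *ᵥ zeta A q)))

/-- Riemannian Hessian of the population objective -/
def hessf {p r : ℕ} (θ : ℝ) (A : Matrix (Fin p) (Fin r) ℝ) (q : Fin p → ℝ) :
    Matrix (Fin p) (Fin p) ℝ :=
  -((1 - θ) • (proj q *
      ((3 : ℝ) • (A * Matrix.diagonal (fun j => (zeta A q j) ^ 2) * Aᵀ)
        - l4p4 (zeta A q) • (1 : Matrix (Fin p) (Fin p) ℝ)) * proj q))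
  - θ • (proj q *
      (l2sq (zeta A q) • (A * Aᵀ)
        + (2 : ℝ) • (A * Aᵀ * Matrix.vecMulVec q q * (A * Aᵀ))
        - (l2sq (zeta A q)) ^ 2 • (1 : Matrix (Fin p) (Fin p) ℝ)) * proj q)

/-- quadratic form -/
def qform {p : ℕ} (M : Matrix (Fin p) (Fin p) ℝ) (v : Fin p → ℝ) : ℝ := v ⬝ᵥ (M *ᵥ v)

/-- α(q) -/
def alphaf {p r : ℕ} (θ : ℝ) (A : Matrix (Fin p) (Fin r) ℝ) (q : Fin p → ℝ) : ℝ :=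
  l4p4 (zeta A q) + (θ / (1 - θ)) * ((l2sq (zeta A q)) ^ 2 - l2sq (zeta A q))

/-- columns of X -/
def colX {r n : ℕ} (X : Matrix (Fin r) (Fin n) ℝ) (k : Fin n) : Fin r → ℝ := fun i => X i k

/-- finite-sample objective -/
def Ffun {p r n : ℕ} (θ σ : ℝ) (A : Matrix (Fin p) (Fin r) ℝ) (X : Matrix (Fin r) (Fin n) ℝ)
    (q : Fin p → ℝ) : ℝ :=
  -(1 / (12 * θ * σ ^ 4 * n)) * ∑ k : Fin n, (q ⬝ᵥ (A *ᵥ colX X k)) ^ 4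

/-- Riemannian gradient of the finite-sample objective -/
def gradF {p r n : ℕ} (θ σ : ℝ) (A : Matrix (Fin p) (Fin r) ℝ) (X : Matrix (Fin r) (Fin n) ℝ)
    (q : Fin p → ℝ) : Fin p → ℝ :=
  (-(1 / (3 * θ * σ ^ 4 * n))) •
    ((proj q) *ᵥ ∑ k : Fin n, ((q ⬝ᵥ (A *ᵥ colX X k)) ^ 3) • (A *ᵥ colX X k))

/-- Riemannian Hessian of the finite-sample objective -/
def hessF {p r n : ℕ} (θ σ : ℝ) (A : Matrix (Fin p) (Fin r) ℝ) (X : Matrix (Fin r) (Fin n) ℝ)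
    (q : Fin p → ℝ) : Matrix (Fin p) (Fin p) ℝ :=
  (-(1 / (3 * θ * σ ^ 4 * n))) •
    ∑ k : Fin n, proj q *
      ((3 * (q ⬝ᵥ (A *ᵥ colX X k)) ^ 2) • Matrix.vecMulVec (A *ᵥ colX X k) (A *ᵥ colX X k)
        - ((q ⬝ᵥ (A *ᵥ colX X k)) ^ 4) • (1 : Matrix (Fin p) (Fin p) ℝ)) * proj q

/-- spectral norm of a rectangular matrix -/
def opNorm {m n : ℕ} (M : Matrix (Fin m) (Fin n) ℝ) : ℝ :=
  ‖LinearMap.toContinuousLinearMap (Matrix.toEuclideanLin M)‖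

/-- Bernoulli(θ) law on ℝ -/
def bernoulliReal (θ : ℝ) : Measure ℝ :=
  ENNReal.ofReal θ • Measure.dirac (1 : ℝ) + ENNReal.ofReal (1 - θ) • Measure.dirac (0 : ℝ)

/-- Bernoulli–Gaussian law BG(θ, σ²) on ℝ -/
def bgLaw (θ σ2 : ℝ) : Measure ℝ :=
  ((bernoulliReal θ).prod (gaussianReal 0 σ2.toNNReal)).map fun p => p.1 * p.2

/-- law of a random vector in ℝ^r with i.i.d. BG(θ, σ²) entries -/
def bgVec (r : ℕ) (θ σ2 : ℝ) : Measure (Fin r → ℝ) :=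
  Measure.pi fun _ : Fin r => bgLaw θ σ2

/-- law of a random r×n matrix with i.i.d. BG(θ, σ²) entries -/
def bgMatrix (r n : ℕ) (θ σ2 : ℝ) : Measure (Fin r → Fin n → ℝ) :=
  Measure.pi fun _ : Fin r => Measure.pi fun _ : Fin n => bgLaw θ σ2


lemma l2sq_eq_dotProduct {m : ℕ} (v : Fin m → ℝ) : l2sq v = v ⬝ᵥ v := by
  simp [l2sq, dotProduct, pow_two]

lemma l2sq_nonneg {m : ℕ} (v : Fin m → ℝ) : 0 ≤ l2sq v :=
  Finset.sum_nonneg fun _ _ => sq_nonneg _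

lemma dotProduct_mulVec_eq_zeta {p r : ℕ} (A : Matrix (Fin p) (Fin r) ℝ) (q : Fin p → ℝ)
    (u : Fin r → ℝ) : q ⬝ᵥ (A *ᵥ u) = zeta A q ⬝ᵥ u := by
  rw [dotProduct_mulVec, zeta, mulVec_transpose]

lemma zeta_mulVec {p r : ℕ} {A : Matrix (Fin p) (Fin r) ℝ} (hA : Aᵀ * A = 1)
    (u : Fin r → ℝ) : zeta A (A *ᵥ u) = u := by
  rw [zeta, mulVec_mulVec, hA, one_mulVec]

lemma mulVec_dotProduct_mulVec {p r : ℕ} {A : Matrix (Fin p) (Fin r) ℝ} (hA : Aᵀ * A = 1)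
    (u w : Fin r → ℝ) : (A *ᵥ u) ⬝ᵥ (A *ᵥ w) = u ⬝ᵥ w := by
  rw [dotProduct_mulVec_eq_zeta, zeta_mulVec hA]

lemma l2sq_zeta_le {p r : ℕ} {A : Matrix (Fin p) (Fin r) ℝ} (hA : Aᵀ * A = 1)
    (q : Fin p → ℝ) : l2sq (zeta A q) ≤ l2sq q := by
  have h := l2sq_nonneg (q - A *ᵥ zeta A q)
  rw [l2sq_eq_dotProduct, sub_dotProduct, dotProduct_sub, dotProduct_sub,
    mulVec_dotProduct_mulVec hA, dotProduct_comm (A *ᵥ zeta A q) q,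
    dotProduct_mulVec_eq_zeta] at h
  rw [l2sq_eq_dotProduct, l2sq_eq_dotProduct q]
  linarith

lemma proj_mulVec {p : ℕ} (q v : Fin p → ℝ) : proj q *ᵥ v = v - (q ⬝ᵥ v) • q := by
  ext i
  simp [proj, sub_mulVec, vecMulVec_mulVec, mul_comm]

lemma transpose_proj {p : ℕ} (q : Fin p → ℝ) : (proj q)ᵀ = proj q := by
  simp [proj, transpose_vecMulVec]

lemma qform_proj_mul_mul_proj {p : ℕ} {q v : Fin p → ℝ} (hv : v ⬝ᵥ q = 0)
    (M : Matrix (Fin p) (Fin p) ℝ) : qform (proj q * M * proj q) v = qform M v := by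
  have h : proj q *ᵥ v = v := by
    rw [proj_mulVec, dotProduct_comm, hv, zero_smul, sub_zero]
  rw [qform, qform, ← mulVec_mulVec, ← mulVec_mulVec, h, dotProduct_mulVec, ← mulVec_transpose,
    transpose_proj, h]

/-- The squared norm of the Riemannian gradient, split along the range of `A` and its orthogonal
complement. -/
lemma l2sq_gradf {p r : ℕ} {A : Matrix (Fin p) (Fin r) ℝ} (hA : Aᵀ * A = 1) (θ : ℝ)
    {q : Fin p → ℝ} (hq : l2sq q = 1) :
    l2sq (gradf θ A q) =
      (∑ j, (zeta A q j * ((1 - θ) * zeta A q j ^ 2 + θ * l2sq (zeta A q)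
        - ((1 - θ) * l4p4 (zeta A q) + θ * l2sq (zeta A q) ^ 2))) ^ 2)
      + ((1 - θ) * l4p4 (zeta A q) + θ * l2sq (zeta A q) ^ 2) ^ 2 * (1 - l2sq (zeta A q)) := by
  set z := zeta A q with hz
  set s := l2sq z with hs
  set l := (1 - θ) * l4p4 z + θ * s ^ 2 with hl
  set u : Fin r → ℝ := fun j => (1 - θ) * z j ^ 3 + θ * s * z j with hu
  have hzu : z ⬝ᵥ u = l := by
    simp only [hl, hu, dotProduct, l4p4]
    rw [pow_two s]
    nth_rewrite 2 [hs]
    rw [l2sq, Finset.mul_sum, Finset.sum_mul, Finset.mul_sum, ← Finset.sum_add_distrib]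
    exact Finset.sum_congr rfl fun j _ => by ring
  have hg : gradf θ A q = -(A *ᵥ u - l • q) := by
    have : (1 - θ) • (A *ᵥ fun j => z j ^ 3) + (θ * s) • (A *ᵥ z) = A *ᵥ u := by
      rw [← mulVec_smul, ← mulVec_smul, ← mulVec_add]
      congr 1
    rw [gradf, ← hz, ← hs, this, proj_mulVec, dotProduct_mulVec_eq_zeta, ← hz, hzu]
  have hleft : l2sq (gradf θ A q) = u ⬝ᵥ u - l ^ 2 := by
    rw [l2sq_eq_dotProduct] at hq
    rw [hg, l2sq_eq_dotProduct, neg_dotProduct_neg, sub_dotProduct, dotProduct_sub,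
      dotProduct_sub, mulVec_dotProduct_mulVec hA, smul_dotProduct, smul_dotProduct,
      dotProduct_smul, dotProduct_smul, dotProduct_comm (A *ᵥ u) q, dotProduct_mulVec_eq_zeta,
      ← hz, hzu, hq]
    simp only [smul_eq_mul]
    ring
  have hright : (∑ j, (z j * ((1 - θ) * z j ^ 2 + θ * s - l)) ^ 2)
      = u ⬝ᵥ u - 2 * l * (z ⬝ᵥ u) + l ^ 2 * s := by
    have hls : l ^ 2 * s = ∑ j, l ^ 2 * z j ^ 2 := by rw [hs, l2sq, Finset.mul_sum]
    rw [hls, dotProduct, dotProduct, Finset.mul_sum,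
      ← Finset.sum_sub_distrib, ← Finset.sum_add_distrib]
    refine Finset.sum_congr rfl fun j _ => ?_
    simp only [hu]
    ring
  rw [hleft, hright, hzu]
  ring

/-- The Riemannian Hessian along a tangent direction in the range of `A`. -/
lemma qform_hessf_mulVec {p r : ℕ} {A : Matrix (Fin p) (Fin r) ℝ} (hA : Aᵀ * A = 1) (θ : ℝ)
    (q : Fin p → ℝ) {w : Fin r → ℝ} (hw : w ⬝ᵥ zeta A q = 0) :
    qform (hessf θ A q) (A *ᵥ w) =
      -((1 - θ) * (3 * (∑ j, w j ^ 2 * zeta A q j ^ 2) - l4p4 (zeta A q) * l2sq w))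
      - θ * ((l2sq (zeta A q) - l2sq (zeta A q) ^ 2) * l2sq w) := by
  have hv : (A *ᵥ w) ⬝ᵥ q = 0 := by
    rw [dotProduct_comm, dotProduct_mulVec_eq_zeta, dotProduct_comm, hw]
  have hAA : (A * Aᵀ) *ᵥ (A *ᵥ w) = A *ᵥ w := by
    rw [← mulVec_mulVec, mulVec_mulVec w Aᵀ A, hA, one_mulVec]
  have hD : (A * diagonal (fun j => zeta A q j ^ 2) * Aᵀ) *ᵥ (A *ᵥ w)
      = A *ᵥ (fun j => zeta A q j ^ 2 * w j) := by
    rw [← mulVec_mulVec, mulVec_mulVec w Aᵀ A, hA, one_mulVec, ← mulVec_mulVec]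
    congr 1
    ext j
    rw [mulVec_diagonal]
  have hQ : (A * Aᵀ * vecMulVec q q * (A * Aᵀ)) *ᵥ (A *ᵥ w) = 0 := by
    rw [← mulVec_mulVec, hAA, ← mulVec_mulVec, vecMulVec_mulVec, dotProduct_comm q, hv]
    simp
  have h1 := qform_proj_mul_mul_proj hv
      ((3 : ℝ) • (A * diagonal (fun j => zeta A q j ^ 2) * Aᵀ)
        - l4p4 (zeta A q) • (1 : Matrix (Fin p) (Fin p) ℝ))
  have h2 := qform_proj_mul_mul_proj hv
      (l2sq (zeta A q) • (A * Aᵀ)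
        + (2 : ℝ) • (A * Aᵀ * vecMulVec q q * (A * Aᵀ))
        - (l2sq (zeta A q)) ^ 2 • (1 : Matrix (Fin p) (Fin p) ℝ))
  have hsum : w ⬝ᵥ (fun j => zeta A q j ^ 2 * w j) = ∑ j, w j ^ 2 * zeta A q j ^ 2 :=
    Finset.sum_congr rfl fun j _ => by ring
  rw [qform, qform, sub_mulVec, smul_mulVec, smul_mulVec, hD, one_mulVec, dotProduct_sub,
    dotProduct_smul, dotProduct_smul, mulVec_dotProduct_mulVec hA,
    mulVec_dotProduct_mulVec hA, hsum, ← l2sq_eq_dotProduct] at h1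
  rw [qform, qform, sub_mulVec, add_mulVec, smul_mulVec, smul_mulVec, smul_mulVec, hAA, hQ,
    one_mulVec, smul_zero, add_zero, dotProduct_sub, dotProduct_smul, dotProduct_smul,
    mulVec_dotProduct_mulVec hA, ← l2sq_eq_dotProduct] at h2
  rw [qform, hessf, sub_mulVec, neg_mulVec, smul_mulVec, smul_mulVec, dotProduct_sub,
    dotProduct_neg, dotProduct_smul, dotProduct_smul, h1, h2]
  simp only [smul_eq_mul]
  ring

lemma qform_le_opNorm_mul_l2sq {p : ℕ} (M : Matrix (Fin p) (Fin p) ℝ) (v : Fin p → ℝ) :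
    qform M v ≤ opNorm M * l2sq v := by
  set x : EuclideanSpace ℝ (Fin p) := WithLp.toLp 2 v
  set T := LinearMap.toContinuousLinearMap (Matrix.toEuclideanLin M)
  have h1 : qform M v = inner ℝ x (T x) := by
    simp [qform, x, T, PiLp.inner_apply, dotProduct, Matrix.toLpLin_apply, mul_comm]
  have h2 : l2sq v = ‖x‖ * ‖x‖ := by
    rw [← pow_two, EuclideanSpace.real_norm_sq_eq]
    rfl
  rw [h1, h2]
  calc inner ℝ x (T x) ≤ ‖x‖ * ‖T x‖ := real_inner_le_norm _ _
    _ ≤ ‖x‖ * (‖T‖ * ‖x‖) := by gcongr; exact T.le_opNorm x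
    _ = opNorm M * (‖x‖ * ‖x‖) := by simp only [opNorm, T]; ring

lemma qform_sub {p : ℕ} (M N : Matrix (Fin p) (Fin p) ℝ) (v : Fin p → ℝ) :
    qform (M - N) v = qform M v - qform N v := by
  rw [qform, sub_mulVec, dotProduct_sub, qform, qform]

lemma l4p4_le_mul_l2sq {m : ℕ} {z : Fin m → ℝ} {b : ℝ} (hb : ∀ j, z j ^ 2 ≤ b) :
    l4p4 z ≤ b * l2sq z := by
  rw [l4p4, l2sq, Finset.mul_sum]
  refine Finset.sum_le_sum fun j _ => ?_
  nlinarith [hb j, sq_nonneg (z j)]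

/-- Testing the Hessian on the rotation in the plane of two coordinates. -/
lemma curvature_two_coordinates {p r : ℕ} {A : Matrix (Fin p) (Fin r) ℝ} (hA : Aᵀ * A = 1)
    {θ δ : ℝ} {q : Fin p → ℝ} (hq : l2sq q = 1) (hθ : 0 ≤ θ)
    {H : Matrix (Fin p) (Fin p) ℝ} (hH : opNorm (H - hessf θ A q) ≤ δ)
    (hpos : ∀ v : Fin p → ℝ, v ⬝ᵥ q = 0 → 0 ≤ qform H v) {i j : Fin r} (hij : j ≠ i) :
    (1 - θ) * (6 * (zeta A q i ^ 2 * zeta A q j ^ 2)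
        - l4p4 (zeta A q) * (zeta A q i ^ 2 + zeta A q j ^ 2))
      ≤ δ * (zeta A q i ^ 2 + zeta A q j ^ 2) := by
  have hs := l2sq_zeta_le hA q
  have hs0 := l2sq_nonneg (zeta A q)
  rw [hq] at hs
  set z := zeta A q with hz
  set w : Fin r → ℝ := Pi.single i (z j) - Pi.single j (z i) with hw
  have hwi : w i = z j := by simp [hw, hij.symm]
  have hwj : w j = - z i := by simp [hw, hij]
  have hwk : ∀ k, k ≠ i ∧ k ≠ j → w k = 0 := fun k hk => by simp [hw, hk.1, hk.2]
  have hwz : w ⬝ᵥ z = 0 := by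
    simp only [hw, sub_dotProduct, single_dotProduct]
    ring
  have hww : l2sq w = z i ^ 2 + z j ^ 2 := by
    rw [l2sq, Fintype.sum_eq_add i j hij.symm fun k hk => by rw [hwk k hk]; ring, hwi, hwj]
    ring
  have hwz2 : (∑ k, w k ^ 2 * z k ^ 2) = 2 * (z i ^ 2 * z j ^ 2) := by
    rw [Fintype.sum_eq_add i j hij.symm fun k hk => by rw [hwk k hk]; ring, hwi, hwj]
    ring
  have hv : (A *ᵥ w) ⬝ᵥ q = 0 := by
    rw [dotProduct_comm, dotProduct_mulVec_eq_zeta, dotProduct_comm, hwz]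
  have hvv : l2sq (A *ᵥ w) = z i ^ 2 + z j ^ 2 := by
    rw [l2sq_eq_dotProduct, mulVec_dotProduct_mulVec hA, ← l2sq_eq_dotProduct, hww]
  have h1 := qform_le_opNorm_mul_l2sq (H - hessf θ A q) (A *ᵥ w)
  rw [qform_sub, qform_hessf_mulVec hA θ q hwz, ← hz, hww, hwz2, hvv] at h1
  have h2 := hpos _ hv
  have hn : 0 ≤ z i ^ 2 + z j ^ 2 := by positivity
  have h3 := mul_le_mul_of_nonneg_right hH hn
  have h4 : 0 ≤ θ * ((l2sq z - l2sq z ^ 2) * (z i ^ 2 + z j ^ 2)) :=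
    mul_nonneg hθ (mul_nonneg (by nlinarith) hn)
  linarith

lemma sq_norm_sub_or_add_col {p r : ℕ} {A : Matrix (Fin p) (Fin r) ℝ} (hA : Aᵀ * A = 1)
    {q : Fin p → ℝ} (hq : l2sq q = 1) (i : Fin r) :
    l2sq (q - fun k => A k i) = 2 - 2 * zeta A q i ∧
      l2sq (q + fun k => A k i) = 2 + 2 * zeta A q i := by
  have hc : (fun k => A k i) = A *ᵥ Pi.single i 1 := by
    ext k
    simp
  have h1 : q ⬝ᵥ (fun k => A k i) = zeta A q i := by
    rw [hc, dotProduct_mulVec_eq_zeta, dotProduct_single_one]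
  have h2 : (fun k => A k i) ⬝ᵥ (fun k => A k i) = 1 := by
    rw [hc, mulVec_dotProduct_mulVec hA]
    simp
  rw [l2sq_eq_dotProduct] at hq
  constructor
  · rw [l2sq_eq_dotProduct, sub_dotProduct, dotProduct_sub, dotProduct_sub,
      dotProduct_comm (fun k => A k i) q, h1, h2, hq]
    ring
  · rw [l2sq_eq_dotProduct, add_dotProduct, dotProduct_add, dotProduct_add,
      dotProduct_comm (fun k => A k i) q, h1, h2, hq]
    ring

/-- Near-stationarity together with a gap between the largest squared entry and all others forces
almost all of the mass onto a single entry. -/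
lemma one_sub_sq_le_of_gap {r : ℕ} {z : Fin r → ℝ} {θ δ : ℝ} {i : Fin r}
    (hθ : 0 < θ) (hθ' : θ ≤ 1 / 9) (hδ0 : 0 ≤ δ) (hδ : δ ≤ 5 / 10 ^ 5)
    (hs : l2sq z ≤ 1) (hi : 1 / 5 ≤ z i ^ 2)
    (hgrad : (∑ j, (z j * ((1 - θ) * z j ^ 2 + θ * l2sq z
        - ((1 - θ) * l4p4 z + θ * l2sq z ^ 2))) ^ 2)
      + ((1 - θ) * l4p4 z + θ * l2sq z ^ 2) ^ 2 * (1 - l2sq z) ≤ δ ^ 2)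
    (hgap : ∀ j, j ≠ i → z j ^ 2 ≤ z i ^ 2 / 4) :
    1 - z i ^ 2 ≤ 1000 * δ ^ 2 := by
  set s := l2sq z with hsdef
  set l := (1 - θ) * l4p4 z + θ * s ^ 2 with hl
  have hterm0 : ∀ j ∈ Finset.univ, 0 ≤ (z j * ((1 - θ) * z j ^ 2 + θ * s - l)) ^ 2 :=
    fun _ _ => sq_nonneg _
  have hsum0 := Finset.sum_nonneg hterm0
  have hperp0 : 0 ≤ l ^ 2 * (1 - s) := mul_nonneg (sq_nonneg _) (by linarith)
  have hsi : z i ^ 2 ≤ s :=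
    Finset.single_le_sum (f := fun j => z j ^ 2) (fun _ _ => sq_nonneg _) (Finset.mem_univ i)
  have hLi : z i ^ 4 ≤ l4p4 z :=
    Finset.single_le_sum (f := fun j => z j ^ 4) (fun _ _ => by positivity) (Finset.mem_univ i)
  have hl25 : 1 / 25 ≤ l := by
    have h1 : 1 / 25 ≤ l4p4 z := by nlinarith
    have h2 : 1 / 25 ≤ s ^ 2 := by nlinarith
    nlinarith
  have hs1 : 1 - s ≤ 625 * δ ^ 2 := by
    have h1 : 1 / 625 ≤ l ^ 2 := by nlinarith
    nlinarith
  have hti : (z i * ((1 - θ) * z i ^ 2 + θ * s - l)) ^ 2 ≤ δ ^ 2 :=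
    (Finset.single_le_sum hterm0 (Finset.mem_univ i)).trans (by linarith)
  have hlow : -(1 / 1000) ≤ l - θ * s - (1 - θ) * z i ^ 2 := by
    rw [mul_pow] at hti
    set t := (1 - θ) * z i ^ 2 + θ * s - l with ht
    have h1 : t ^ 2 ≤ 5 * δ ^ 2 := by nlinarith [sq_nonneg t]
    have h2 : t ^ 2 ≤ (1 / 1000) ^ 2 := by nlinarith
    have h3 := abs_le_of_sq_le_sq' h2 (by norm_num)
    linarith [h3.2]
  have hrest : ∑ j ∈ Finset.univ.erase i, z j ^ 2 ≤ 200 * δ ^ 2 := by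
    have h1 : ∑ j ∈ Finset.univ.erase i, z j ^ 2 ≤
        ∑ j ∈ Finset.univ.erase i,
          200 * (z j * ((1 - θ) * z j ^ 2 + θ * s - l)) ^ 2 := by
      refine Finset.sum_le_sum fun j hj => ?_
      have hg := hgap j (Finset.ne_of_mem_erase hj)
      have h2 : 1 / 10 ≤ l - θ * s - (1 - θ) * z j ^ 2 := by
        have h3 : 8 / 9 * (3 / 20) ≤ (1 - θ) * (z i ^ 2 - z j ^ 2) :=
          mul_le_mul (by linarith) (by linarith) (by norm_num) (by linarith)
        linarith
      have h4 := pow_le_pow_left₀ (by norm_num) h2 2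
      have h5 := mul_le_mul_of_nonneg_left h4 (sq_nonneg (z j))
      linarith [sq_nonneg (z j)]
    rw [← Finset.mul_sum] at h1
    have h4 := Finset.sum_le_sum_of_subset_of_nonneg
      (Finset.erase_subset i Finset.univ) (fun j hj _ => hterm0 j hj)
    linarith
  have hsplit : z i ^ 2 + ∑ j ∈ Finset.univ.erase i, z j ^ 2 = s :=
    Finset.add_sum_erase Finset.univ (fun j => z j ^ 2) (Finset.mem_univ i)
  linarith [sq_nonneg δ]

theorem stmt10 : ∃ C : ℝ, 0 < C ∧
    ∀ (p r n : ℕ), 1 ≤ r → r ≤ p → 1 ≤ n →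
    ∀ (A : Matrix (Fin p) (Fin r) ℝ), Aᵀ * A = 1 →
    ∀ (X : Matrix (Fin r) (Fin n) ℝ) (θ σ Cstar δ1 δ2 : ℝ),
      0 < θ → θ ≤ 1/9 → 0 < σ → 1/5 ≤ Cstar →
      δ1 ≤ 5/10^5 → δ2 ≤ 1/10^3 →
      (∀ q : Fin p → ℝ, l2sq q = 1 → l2norm (gradF θ σ A X q - gradf θ A q) ≤ δ1) →
      (∀ q : Fin p → ℝ, l2sq q = 1 → opNorm (hessF θ σ A X q - hessf θ A q) ≤ δ2) →
      ∀ qb : Fin p → ℝ, l2sq qb = 1 → Cstar ≤ linfSq (zeta A qb) →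
        gradF θ σ A X qb = 0 →
        (∀ v : Fin p → ℝ, v ⬝ᵥ qb = 0 → 0 ≤ qform (hessF θ σ A X qb) v) →
        ∃ i : Fin r,
          l2sq (qb - fun k => A k i) ≤ C * δ1 ∨ l2sq (qb + fun k => A k i) ≤ C * δ1 := by
  refine ⟨1, one_pos, ?_⟩
  intro p r n hr _ _ A hA X θ σ Cstar δ1 δ2 hθ hθ' _ hC hδ1 hδ2 hgrad hhess q hq hinf hg0 hpos
  have : Nonempty (Fin r) := ⟨⟨0, hr⟩⟩
  obtain ⟨i, hi⟩ := exists_eq_ciSup_of_finite (f := fun j => zeta A q j ^ 2)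
  have hmax : ∀ j, zeta A q j ^ 2 ≤ zeta A q i ^ 2 := fun j => by
    have h := le_ciSup (Set.finite_range fun j => zeta A q j ^ 2).bddAbove j
    rwa [← hi] at h
  have hi5 : 1 / 5 ≤ zeta A q i ^ 2 := by
    rw [linfSq, ← hi] at hinf
    linarith
  have hs : l2sq (zeta A q) ≤ 1 := hq ▸ l2sq_zeta_le hA q
  have hd := hgrad q hq
  have hδ0 : 0 ≤ δ1 := (Real.sqrt_nonneg _).trans hd
  have hgr : l2sq (gradf θ A q) ≤ δ1 ^ 2 := by
    rw [hg0, l2norm, Real.sqrt_le_left hδ0] at hd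
    simpa [l2sq] using hd
  rw [l2sq_gradf hA θ hq] at hgr
  have hL : l4p4 (zeta A q) ≤ zeta A q i ^ 2 :=
    (l4p4_le_mul_l2sq hmax).trans (by nlinarith)
  have hgap : ∀ j, j ≠ i → zeta A q j ^ 2 ≤ zeta A q i ^ 2 / 4 := by
    intro j hj
    have h := curvature_two_coordinates hA hq hθ.le (hhess q hq) hpos hj
    have hm := hmax j
    have hy := sq_nonneg (zeta A q j)
    set m := zeta A q i ^ 2
    set y := zeta A q j ^ 2
    by_contra! hlt
    have h1 : m * (5 * y - m) ≤ 6 * (m * y) - l4p4 (zeta A q) * (m + y) := by nlinarith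
    have h2 : m * (m / 4) ≤ m * (5 * y - m) := by
      apply mul_le_mul_of_nonneg_left <;> linarith
    have h3 : δ2 * (m + y) ≤ 1 / 10 ^ 3 * (2 * m) := by nlinarith
    nlinarith
  have hmass := one_sub_sq_le_of_gap hθ hθ' hδ0 hδ1 hs hi5 hgr hgap
  have hz1 : zeta A q i ^ 2 ≤ 1 := (Finset.single_le_sum (f := fun j => zeta A q j ^ 2)
    (fun _ _ => sq_nonneg _) (Finset.mem_univ i)).trans hs
  obtain ⟨hminus, hplus⟩ := sq_norm_sub_or_add_col hA hq i
  refine ⟨i, ?_⟩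
  rw [hminus, hplus]
  have hz := abs_le_of_sq_le_sq' (a := zeta A q i) (b := 1) (by linarith) one_pos.le
  rcases le_total 0 (zeta A q i) with h | h
  · left; nlinarith
  · right; nlinarith

end
end

section
/- There exist absolute constants C, C', C'', c, c' > 0 with the following property. Let 1 ≤ r ≤ p, θ ∈ (0,1], σ > 0, n ≥ 2, let A ∈ ℝ^{p×r} satisfy AᵀA = I_r, and let X be a random r×n matrix with i.i.d. BG(θ,σ²) entries. Set M_n = C'(n+r)(θr² + (log n)²/θ). Then with probability at least 1 − c·n^{−c'}, sup over unit vectors q ∈ ℝ^p of |F(q) − f(q)| ≤ C''·[√(r·log(M_n)/(θn)) + (M_n/n)·(r·log(M_n)/n)]. -/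
open Matrix MeasureTheory ProbabilityTheory Real
open scoped BigOperators ENNReal

noncomputable section

/-! ### The Bernoulli–Gaussian law -/

lemma bgLaw_eq (θ s : ℝ) : bgLaw θ s =
    ENNReal.ofReal θ • gaussianReal 0 s.toNNReal
      + ENNReal.ofReal (1 - θ) • Measure.dirac (0 : ℝ) := by
  have hm : Measurable fun p : ℝ × ℝ => p.1 * p.2 := by fun_prop
  unfold bgLaw bernoulliReal
  rw [Measure.add_prod, Measure.prod_smul_left, Measure.prod_smul_left,
    Measure.dirac_prod, Measure.dirac_prod, Measure.map_add _ _ hm, Measure.map_smul,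
    Measure.map_smul, Measure.map_map hm (by fun_prop), Measure.map_map hm (by fun_prop)]
  congr 2
  · convert Measure.map_id
    ext x; simp
  · have : ((fun p : ℝ × ℝ => p.1 * p.2) ∘ Prod.mk 0) = fun _ => (0 : ℝ) := by
      ext x; simp
    rw [this, Measure.map_const]
    simp

lemma isProbabilityMeasure_bgLaw {θ : ℝ} (s : ℝ) (h0 : 0 ≤ θ) (h1 : θ ≤ 1) :
    IsProbabilityMeasure (bgLaw θ s) := by
  refine ⟨?_⟩
  rw [bgLaw_eq]
  simp only [Measure.coe_add, Measure.coe_smul, Pi.add_apply, Pi.smul_apply, measure_univ,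
    smul_eq_mul, mul_one]
  rw [← ENNReal.ofReal_add h0 (by linarith)]
  simp

lemma integral_bgLaw {θ : ℝ} (s : ℝ) (h0 : 0 ≤ θ) (h1 : θ ≤ 1) {f : ℝ → ℝ}
    (hf : Integrable f (gaussianReal 0 s.toNNReal)) :
    Integrable f (bgLaw θ s) ∧
      ∫ x, f x ∂(bgLaw θ s) = θ * ∫ x, f x ∂(gaussianReal 0 s.toNNReal) + (1 - θ) * f 0 := by
  have h2 : Integrable f (ENNReal.ofReal θ • gaussianReal 0 s.toNNReal) :=
    hf.smul_measure ENNReal.ofReal_ne_top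
  have h3 : Integrable f (ENNReal.ofReal (1 - θ) • Measure.dirac (0 : ℝ)) :=
    (integrable_dirac (by simp)).smul_measure ENNReal.ofReal_ne_top
  rw [bgLaw_eq]
  refine ⟨h2.add_measure h3, ?_⟩
  rw [integral_add_measure h2 h3, integral_smul_measure, integral_smul_measure, integral_dirac,
    ENNReal.toReal_ofReal h0, ENNReal.toReal_ofReal (by linarith)]
  simp

lemma bgLaw_map_div {θ σ : ℝ} (hσ : 0 < σ) :
    (bgLaw θ (σ ^ 2)).map (fun x => x / σ) = bgLaw θ 1 := by
  have hm : Measurable fun x : ℝ => x / σ := by fun_prop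
  rw [bgLaw_eq, bgLaw_eq, Measure.map_add _ _ hm, Measure.map_smul, Measure.map_smul,
    gaussianReal_map_div_const, Measure.map_dirac' hm]
  congr 3
  · simp
  · ext
    simp [hσ.ne', Real.coe_toNNReal _ (sq_nonneg σ)]
  · simp

lemma integrable_pow_gaussianReal (v : NNReal) (k : ℕ) :
    Integrable (fun x : ℝ => x ^ k) (gaussianReal 0 v) := by
  by_cases hk : k = 0
  · subst hk; simp
  have h := (memLp_id_gaussianReal (μ := 0) (v := v) k).integrable_norm_rpow (by simpa using hk)
    (by simp)
  refine (integrable_norm_iff (by fun_prop)).1 ?_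
  simpa using h

lemma integral_pow_four_gaussianReal : ∫ x, x ^ 4 ∂(gaussianReal 0 1) = 3 := by
  have h := iteratedDeriv_mgf_zero (X := (id : ℝ → ℝ)) (μ := gaussianReal 0 1)
    (by simp [integrableExpSet_id_gaussianReal]) 4
  have h1 : (id : ℝ → ℝ) ^ 4 = fun x => x ^ 4 := by ext; simp
  rw [h1] at h
  rw [← h, mgf_id_gaussianReal]
  have hE : ∀ t : ℝ, HasDerivAt (fun t : ℝ => rexp (t ^ 2 / 2)) (t * rexp (t ^ 2 / 2)) t := by
    intro t
    have := ((hasDerivAt_pow 2 t).div_const 2).exp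
    convert this using 1
    simp; ring
  have d1 : deriv (fun t : ℝ => rexp (t ^ 2 / 2)) = fun t => t * rexp (t ^ 2 / 2) :=
    funext fun t => (hE t).deriv
  have d2 : deriv (fun t : ℝ => t * rexp (t ^ 2 / 2)) = fun t => (1 + t ^ 2) * rexp (t ^ 2 / 2) := by
    funext t
    rw [((hasDerivAt_id' t).fun_mul (hE t)).deriv]; ring
  have d3 : deriv (fun t : ℝ => (1 + t ^ 2) * rexp (t ^ 2 / 2))
      = fun t => (3 * t + t ^ 3) * rexp (t ^ 2 / 2) := by
    funext t
    rw [(((hasDerivAt_pow 2 t).const_add 1).fun_mul (hE t)).deriv]; simp; ring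
  have d4 : deriv (fun t : ℝ => (3 * t + t ^ 3) * rexp (t ^ 2 / 2))
      = fun t => (3 + 6 * t ^ 2 + t ^ 4) * rexp (t ^ 2 / 2) := by
    funext t
    rw [((((hasDerivAt_id' t).const_mul 3).fun_add (hasDerivAt_pow 3 t)).fun_mul (hE t)).deriv]
    simp; ring
  simp only [NNReal.coe_one, zero_mul, one_mul, zero_add, iteratedDeriv_succ, iteratedDeriv_zero,
    d1, d2, d3, d4]
  simp

lemma integral_pow_two_gaussianReal : ∫ x, x ^ 2 ∂(gaussianReal 0 1) = 1 := by
  have h := variance_fun_id_gaussianReal (μ := 0) (v := 1)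
  rw [variance_eq_integral (by fun_prop)] at h
  simpa using h

lemma integral_pow_three_gaussianReal : ∫ x, x ^ 3 ∂(gaussianReal 0 1) = 0 := by
  have h : ∫ x, x ^ 3 ∂((gaussianReal 0 1).map (fun x => -x)) = ∫ x, x ^ 3 ∂(gaussianReal 0 1) := by
    rw [gaussianReal_map_neg]; simp
  rw [integral_map (by fun_prop) (by fun_prop)] at h
  simp only [Odd.neg_pow (by decide : Odd 3), integral_neg] at h
  linarith

lemma integral_exp_sq_gaussianReal : ∫ x, rexp (x ^ 2 / 4) ∂(gaussianReal 0 1) = √2 := by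
  rw [integral_gaussianReal_eq_integral_smul (by simp)]
  have : ∀ x : ℝ, gaussianPDFReal 0 1 x • rexp (x ^ 2 / 4)
      = (√(2 * π))⁻¹ * rexp (-(1 / 4) * x ^ 2) := by
    intro x
    rw [gaussianPDFReal, smul_eq_mul, mul_assoc, ← Real.exp_add]
    simp only [NNReal.coe_one, mul_one, sub_zero]
    congr 2; ring
  simp_rw [this]
  rw [integral_const_mul, integral_gaussian, ← Real.sqrt_inv, ← Real.sqrt_mul (by positivity)]
  congr 1
  field_simp
  norm_num

lemma integral_pow_bgLaw {θ : ℝ} (h0 : 0 ≤ θ) (h1 : θ ≤ 1) :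
    (∀ k : ℕ, Integrable (fun x : ℝ => x ^ k) (bgLaw θ 1)) ∧
    ∫ x, x ^ 1 ∂(bgLaw θ 1) = 0 ∧ ∫ x, x ^ 2 ∂(bgLaw θ 1) = θ ∧
    ∫ x, x ^ 3 ∂(bgLaw θ 1) = 0 ∧ ∫ x, x ^ 4 ∂(bgLaw θ 1) = 3 * θ := by
  have h := fun k => integral_bgLaw 1 h0 h1 (integrable_pow_gaussianReal (Real.toNNReal 1) k)
  refine ⟨fun k => (h k).1, ?_, ?_, ?_, ?_⟩
  · rw [(h 1).2]; simp
  · rw [(h 2).2]; simp [integral_pow_two_gaussianReal]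
  · rw [(h 3).2]; simp [integral_pow_three_gaussianReal]
  · rw [(h 4).2]; simp [integral_pow_four_gaussianReal]; ring

lemma integral_exp_mul_bgLaw {θ : ℝ} (h0 : 0 ≤ θ) (h1 : θ ≤ 1) (t : ℝ) :
    Integrable (fun x : ℝ => rexp (t * x)) (bgLaw θ 1) ∧
    ∫ x, rexp (t * x) ∂(bgLaw θ 1) = θ * rexp (t ^ 2 / 2) + (1 - θ) := by
  have h := integral_bgLaw 1 h0 h1
    (integrable_exp_mul_gaussianReal (μ := 0) (v := Real.toNNReal 1) t)
  refine ⟨h.1, ?_⟩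
  have h2 := congrFun (mgf_fun_id_gaussianReal (μ := 0) (v := Real.toNNReal 1)) t
  simp only [mgf] at h2
  rw [h.2, h2]
  simp

lemma integral_exp_sq_bgLaw {θ : ℝ} (h0 : 0 ≤ θ) (h1 : θ ≤ 1) :
    Integrable (fun x : ℝ => rexp (x ^ 2 / 4)) (bgLaw θ 1) ∧
    ∫ x, rexp (x ^ 2 / 4) ∂(bgLaw θ 1) ≤ rexp θ := by
  have hi : Integrable (fun x : ℝ => rexp (x ^ 2 / 4)) (gaussianReal 0 (Real.toNNReal 1)) := by
    by_contra hc
    have := integral_undef hc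
    rw [Real.toNNReal_one, integral_exp_sq_gaussianReal] at this
    simp at this
  have h := integral_bgLaw 1 h0 h1 hi
  refine ⟨h.1, ?_⟩
  rw [h.2, Real.toNNReal_one, integral_exp_sq_gaussianReal]
  have h2 : √2 ≤ 2 := by
    rw [Real.sqrt_le_left (by norm_num)]; norm_num
  have h3 := Real.add_one_le_exp θ
  simp
  nlinarith

/-! ### Random vectors with independent Bernoulli–Gaussian entries -/

lemma isProbabilityMeasure_bgVec {θ : ℝ} (r : ℕ) (s : ℝ) (h0 : 0 ≤ θ) (h1 : θ ≤ 1) :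
    IsProbabilityMeasure (bgVec r θ s) := by
  have := isProbabilityMeasure_bgLaw s h0 h1
  unfold bgVec; infer_instance

lemma integral_exp_dotProduct_bgVec {θ : ℝ} {r : ℕ} (h0 : 0 ≤ θ) (h1 : θ ≤ 1) (ζ : Fin r → ℝ) :
    Integrable (fun x => rexp (ζ ⬝ᵥ x)) (bgVec r θ 1) ∧
    ∫ x, rexp (ζ ⬝ᵥ x) ∂(bgVec r θ 1) = ∏ i, (θ * rexp (ζ i ^ 2 / 2) + (1 - θ)) := by
  have := isProbabilityMeasure_bgLaw 1 h0 h1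
  have he : (fun x : Fin r → ℝ => rexp (ζ ⬝ᵥ x)) = fun x => ∏ i, rexp (ζ i * x i) := by
    ext x; rw [← Real.exp_sum]; rfl
  rw [he]
  unfold bgVec
  constructor
  · exact Integrable.fintype_prod (f := fun i x => rexp (ζ i * x))
      fun i => (integral_exp_mul_bgLaw h0 h1 (ζ i)).1
  · rw [integral_fintype_prod_eq_prod (fun i x => rexp (ζ i * x))]
    exact Finset.prod_congr rfl fun i _ => (integral_exp_mul_bgLaw h0 h1 (ζ i)).2

lemma integrable_dotProduct_pow_bgVec {θ : ℝ} {r : ℕ} (h0 : 0 ≤ θ) (h1 : θ ≤ 1) (ζ : Fin r → ℝ)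
    (k : ℕ) : Integrable (fun x => (ζ ⬝ᵥ x) ^ k) (bgVec r θ 1) := by
  have i1 := (integral_exp_dotProduct_bgVec h0 h1 ζ).1
  have i2 := (integral_exp_dotProduct_bgVec h0 h1 (-ζ)).1
  refine ((i1.add i2).const_mul (k.factorial : ℝ)).mono' ?_ (ae_of_all _ fun x => ?_)
  · exact Measurable.aestronglyMeasurable (by unfold dotProduct; fun_prop)
  · have h := Real.pow_div_factorial_le_exp |ζ ⬝ᵥ x| (abs_nonneg _) k
    rw [div_le_iff₀' (by positivity)] at h
    simp only [norm_pow, Real.norm_eq_abs, Pi.add_apply, neg_dotProduct]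
    refine h.trans ?_
    gcongr
    rcases abs_cases (ζ ⬝ᵥ x) with ⟨h, _⟩ | ⟨h, _⟩ <;> rw [h] <;> simp <;> positivity

lemma pow_eight_le_cosh (u : ℝ) : u ^ 8 ≤ 40320 * (Real.cosh u - 1) := by
  have h := (Real.hasSum_cosh u)
  have h2 := sum_le_hasSum {0, 4} (fun i _ => by
    rw [pow_mul]; positivity) h
  simp [Nat.factorial] at h2
  linarith

lemma integral_dotProduct_pow_eight_le {θ : ℝ} {r : ℕ} (h0 : 0 ≤ θ) (h1 : θ ≤ 1) (ζ : Fin r → ℝ)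
    (hζ : l2sq ζ ≤ 1) : ∫ x, (ζ ⬝ᵥ x) ^ 8 ∂(bgVec r θ 1) ≤ 80640 * θ := by
  have := isProbabilityMeasure_bgVec r 1 h0 h1
  obtain ⟨i1, e1⟩ := integral_exp_dotProduct_bgVec h0 h1 ζ
  obtain ⟨i2, e2⟩ := integral_exp_dotProduct_bgVec h0 h1 (-ζ)
  have hterm : ∀ i, θ * rexp (ζ i ^ 2 / 2) + (1 - θ) ≤ rexp (θ * ζ i ^ 2) := by
    intro i
    have hi : ζ i ^ 2 ≤ 1 := (Finset.single_le_sum (f := fun i => ζ i ^ 2)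
      (fun i _ => sq_nonneg _) (Finset.mem_univ i)).trans hζ
    have hx : rexp (ζ i ^ 2 / 2) ≤ 1 + ζ i ^ 2 := by
      have := Real.abs_exp_sub_one_le (x := ζ i ^ 2 / 2)
        (by rw [abs_of_nonneg (by positivity)]; linarith)
      rw [abs_of_nonneg (a := ζ i ^ 2 / 2) (by positivity)] at this
      linarith [le_abs_self (rexp (ζ i ^ 2 / 2) - 1)]
    have := Real.add_one_le_exp (θ * ζ i ^ 2)
    nlinarith
  have hprod : ∏ i, (θ * rexp (ζ i ^ 2 / 2) + (1 - θ)) ≤ 1 + 2 * θ := by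
    calc _ ≤ ∏ i, rexp (θ * ζ i ^ 2) := Finset.prod_le_prod (fun i _ => by
            have : 0 ≤ 1 - θ := by linarith
            positivity) fun i _ => hterm i
      _ = rexp (θ * l2sq ζ) := by rw [← Real.exp_sum, ← Finset.mul_sum, l2sq]
      _ ≤ rexp θ := by
        gcongr; nlinarith
      _ ≤ 1 + 2 * θ := by
        have := Real.abs_exp_sub_one_le (x := θ) (by rwa [abs_of_nonneg h0])
        rw [abs_of_nonneg h0] at this
        linarith [le_abs_self (rexp θ - 1)]
  have hcosh : ∀ x : Fin r → ℝ, Real.cosh (ζ ⬝ᵥ x) - 1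
      = (rexp (ζ ⬝ᵥ x) + rexp (-ζ ⬝ᵥ x)) / 2 - 1 := by
    intro x; rw [Real.cosh_eq, neg_dotProduct]
  calc ∫ x, (ζ ⬝ᵥ x) ^ 8 ∂(bgVec r θ 1)
      ≤ ∫ x, 40320 * ((rexp (ζ ⬝ᵥ x) + rexp (-ζ ⬝ᵥ x)) / 2 - 1) ∂(bgVec r θ 1) := by
        refine integral_mono (integrable_dotProduct_pow_bgVec h0 h1 ζ 8)
          ((((i1.add i2).div_const 2).sub (integrable_const 1)).const_mul _) fun x => ?_
        show (ζ ⬝ᵥ x) ^ 8 ≤ _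
        rw [← hcosh]; exact pow_eight_le_cosh _
    _ = 40320 * ((∏ i, (θ * rexp (ζ i ^ 2 / 2) + (1 - θ))) - 1) := by
        rw [integral_const_mul, integral_sub ((i1.fun_add i2).div_const 2) (integrable_const 1),
          integral_div, integral_add i1 i2, e1, e2]
        simp
    _ ≤ 80640 * θ := by linarith

lemma bgVec_l2sq_tail {θ : ℝ} (r n : ℕ) (h0 : 0 ≤ θ) (h1 : θ ≤ 1) (hn : 1 ≤ n) :
    (bgVec r θ 1).real {x | 4 * θ * r + 8 * Real.log n ≤ l2sq x} ≤ ((n : ℝ) ^ 2)⁻¹ := by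
  have hP := isProbabilityMeasure_bgLaw 1 h0 h1
  have hV := isProbabilityMeasure_bgVec r 1 h0 h1
  have hn' : (0 : ℝ) < n := by exact_mod_cast hn
  have he : (fun x : Fin r → ℝ => rexp (1 / 4 * l2sq x)) = fun x => ∏ i, rexp (x i ^ 2 / 4) := by
    ext x; rw [← Real.exp_sum, l2sq, Finset.mul_sum]
    congr 1; exact Finset.sum_congr rfl fun i _ => by ring
  have hint : Integrable (fun x : Fin r → ℝ => rexp (1 / 4 * l2sq x)) (bgVec r θ 1) := by
    rw [he]
    exact Integrable.fintype_prod (f := fun i x => rexp (x ^ 2 / 4))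
      fun i => (integral_exp_sq_bgLaw h0 h1).1
  have hmgf : mgf l2sq (bgVec r θ 1) (1 / 4) ≤ rexp (θ * r) := by
    rw [mgf, he, bgVec, integral_fintype_prod_eq_prod (fun i x => rexp (x ^ 2 / 4))]
    rw [Finset.prod_const, Finset.card_univ, Fintype.card_fin, mul_comm, Real.exp_nat_mul]
    exact pow_le_pow_left₀ (integral_nonneg fun x => by positivity)
      (integral_exp_sq_bgLaw h0 h1).2 _
  refine (measure_ge_le_exp_mul_mgf (4 * θ * r + 8 * Real.log n) (by norm_num : (0:ℝ) ≤ 1 / 4)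
    hint).trans ?_
  calc _ ≤ rexp (-(1 / 4) * (4 * θ * r + 8 * Real.log n)) * rexp (θ * r) := by gcongr
    _ = rexp (-(2 * Real.log n)) := by rw [← Real.exp_add]; ring_nf
    _ = ((n : ℝ) ^ 2)⁻¹ := by
      rw [Real.exp_neg, two_mul, Real.exp_add, Real.exp_log hn', sq]

lemma integral_add_pow_of_indepFun {Ω : Type*} [MeasurableSpace Ω] {μ : Measure Ω}
    [IsProbabilityMeasure μ] {S Y : Ω → ℝ} (hSY : IndepFun S Y μ)
    (iS : ∀ k : ℕ, Integrable (fun ω => S ω ^ k) μ)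
    (iY : ∀ k : ℕ, Integrable (fun ω => Y ω ^ k) μ)
    (y1 : ∫ ω, Y ω ^ 1 ∂μ = 0) (y3 : ∫ ω, Y ω ^ 3 ∂μ = 0) :
    ∫ ω, (S ω + Y ω) ^ 2 ∂μ = ∫ ω, S ω ^ 2 ∂μ + ∫ ω, Y ω ^ 2 ∂μ ∧
    ∫ ω, (S ω + Y ω) ^ 4 ∂μ = ∫ ω, S ω ^ 4 ∂μ + 6 * ((∫ ω, S ω ^ 2 ∂μ) * ∫ ω, Y ω ^ 2 ∂μ)
      + ∫ ω, Y ω ^ 4 ∂μ := by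
  have hind : ∀ a b : ℕ, IndepFun (fun ω => S ω ^ a) (fun ω => Y ω ^ b) μ := fun a b =>
    hSY.comp (φ := fun x => x ^ a) (ψ := fun x => x ^ b) (by fun_prop) (by fun_prop)
  have hi : ∀ a b : ℕ, Integrable (fun ω => S ω ^ a * Y ω ^ b) μ := fun a b =>
    (hind a b).integrable_mul (iS a) (iY b)
  have hm : ∀ a b : ℕ, ∫ ω, S ω ^ a * Y ω ^ b ∂μ = (∫ ω, S ω ^ a ∂μ) * ∫ ω, Y ω ^ b ∂μ :=
    fun a b => (hind a b).integral_fun_mul_eq_mul_integral (iS a).1 (iY b).1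
  constructor
  · have : ∀ ω, (S ω + Y ω) ^ 2 = S ω ^ 2 + (2 * (S ω ^ 1 * Y ω ^ 1) + Y ω ^ 2) := fun ω => by ring
    simp_rw [this]
    rw [integral_add (iS 2) (((hi 1 1).const_mul 2).fun_add (iY 2)),
      integral_add ((hi 1 1).const_mul 2) (iY 2), integral_const_mul, hm, y1]
    ring
  · have : ∀ ω, (S ω + Y ω) ^ 4 = S ω ^ 4 + (4 * (S ω ^ 3 * Y ω ^ 1) + (6 * (S ω ^ 2 * Y ω ^ 2)
        + (4 * (S ω ^ 1 * Y ω ^ 3) + Y ω ^ 4))) := fun ω => by ring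
    simp_rw [this]
    have j1 := ((hi 1 3).const_mul 4).fun_add (iY 4)
    have j2 := ((hi 2 2).const_mul 6).fun_add j1
    have j3 := ((hi 3 1).const_mul 4).fun_add j2
    rw [integral_add (iS 4) j3, integral_add ((hi 3 1).const_mul 4) j2,
      integral_add ((hi 2 2).const_mul 6) j1, integral_add ((hi 1 3).const_mul 4) (iY 4)]
    simp_rw [integral_const_mul, hm]
    rw [y1, y3]
    ring

lemma integral_dotProduct_pow_four {θ : ℝ} {r : ℕ} (h0 : 0 ≤ θ) (h1 : θ ≤ 1) (ζ : Fin r → ℝ) :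
    ∫ x, (ζ ⬝ᵥ x) ^ 4 ∂(bgVec r θ 1) =
      3 * θ * ((1 - θ) * l4p4 ζ + θ * l2sq ζ ^ 2) := by
  classical
  have hP := isProbabilityMeasure_bgLaw 1 h0 h1
  have hV := isProbabilityMeasure_bgVec r 1 h0 h1
  obtain ⟨ip, m1, m2, m3, m4⟩ := integral_pow_bgLaw h0 h1
  have hind : iIndepFun (fun i (x : Fin r → ℝ) => ζ i * x i) (bgVec r θ 1) :=
    iIndepFun_pi (X := fun i (y : ℝ) => ζ i * y) fun i => by fun_prop
  have hYi : ∀ i (k : ℕ), Integrable (fun x : Fin r → ℝ => (ζ i * x i) ^ k) (bgVec r θ 1) := by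
    intro i k
    simp_rw [mul_pow]
    exact (integrable_comp_eval (ip k)).const_mul _
  have hYm : ∀ i (k : ℕ), ∫ x : Fin r → ℝ, (ζ i * x i) ^ k ∂(bgVec r θ 1)
      = ζ i ^ k * ∫ x, x ^ k ∂(bgLaw θ 1) := by
    intro i k
    simp_rw [mul_pow]
    rw [integral_const_mul, bgVec, integral_comp_eval (μ := fun _ : Fin r => bgLaw θ 1)
      (f := fun x => x ^ k) (ip k).1]
  have key : ∀ s : Finset (Fin r),
      ∫ x : Fin r → ℝ, (∑ i ∈ s, ζ i * x i) ^ 2 ∂(bgVec r θ 1) = θ * ∑ i ∈ s, ζ i ^ 2 ∧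
      ∫ x : Fin r → ℝ, (∑ i ∈ s, ζ i * x i) ^ 4 ∂(bgVec r θ 1)
        = 3 * θ * ((1 - θ) * (∑ i ∈ s, ζ i ^ 4) + θ * (∑ i ∈ s, ζ i ^ 2) ^ 2) := by
    intro s
    induction s using Finset.induction_on with
    | empty => simp
    | insert j s hj ih =>
      have hSY : IndepFun (fun x : Fin r → ℝ => ∑ i ∈ s, ζ i * x i) (fun x => ζ j * x j)
          (bgVec r θ 1) := by
        convert hind.indepFun_finsetSum_of_notMem (fun i => by fun_prop) hj using 1
        ext x; simp
      have hS : ∀ k : ℕ, Integrable (fun x : Fin r → ℝ => (∑ i ∈ s, ζ i * x i) ^ k)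
          (bgVec r θ 1) := by
        intro k
        convert integrable_dotProduct_pow_bgVec h0 h1 (fun i => if i ∈ s then ζ i else 0) k
          using 3 with x
        simp [dotProduct, Finset.sum_ite_mem]
      have h := integral_add_pow_of_indepFun hSY hS (hYi j)
        (by rw [hYm, m1, mul_zero]) (by rw [hYm, m3, mul_zero])
      rw [ih.1, ih.2, hYm, hYm, m2, m4] at h
      simp only [Finset.sum_insert hj]
      simp_rw [add_comm (ζ j * _)]
      rw [h.1, h.2]
      constructor <;> ring
  exact (key Finset.univ).2

/-! ### Transposing and rescaling the random matrix -/

lemma pi_map_flip {r n : ℕ} (ν : Measure ℝ) [IsProbabilityMeasure ν] :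
    (Measure.pi fun _ : Fin r => Measure.pi fun _ : Fin n => ν).map (fun X k i => X i k)
      = Measure.pi fun _ : Fin n => Measure.pi fun _ : Fin r => ν := by
  symm
  refine Measure.pi_eq_generateFrom
    (C := fun _ : Fin n => Set.pi Set.univ '' Set.pi Set.univ fun _ : Fin r =>
      {s : Set ℝ | MeasurableSet s}) (fun _ => generateFrom_pi) (fun _ => isPiSystem_pi)
    (fun _ => ⟨fun _ => Set.univ, fun _ => ⟨fun _ => Set.univ, by simp, by simp⟩,
      fun _ => by simp, by simp [Set.iUnion_const]⟩) ?_
  intro s hs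
  choose t ht hst using hs
  have hmeas : ∀ k i, MeasurableSet (t k i) := fun k i => ht k i (Set.mem_univ i)
  have hS : MeasurableSet (Set.univ.pi s) := by
    refine MeasurableSet.univ_pi fun k => ?_
    rw [← hst k]
    exact MeasurableSet.univ_pi fun i => hmeas k i
  rw [Measure.map_apply (by fun_prop) hS]
  have hpre : (fun (X : Fin r → Fin n → ℝ) k i => X i k) ⁻¹' Set.univ.pi s
      = Set.univ.pi fun i => Set.univ.pi fun k => t k i := by
    ext X
    simp only [Set.mem_preimage, Set.mem_pi, Set.mem_univ, true_imp_iff, ← hst]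
    exact forall_comm
  rw [hpre, Measure.pi_pi]
  simp_rw [← hst, Measure.pi_pi]
  exact Finset.prod_comm

lemma bgMatrix_map_transpose {r n : ℕ} {θ σ : ℝ} (h0 : 0 ≤ θ) (h1 : θ ≤ 1) (hσ : 0 < σ) :
    (bgMatrix r n θ (σ ^ 2)).map (fun X k i => X i k / σ)
      = Measure.pi fun _ : Fin n => bgVec r θ 1 := by
  have hP1 := isProbabilityMeasure_bgLaw 1 h0 h1
  have hP := isProbabilityMeasure_bgLaw (σ ^ 2) h0 h1
  have hscale : (bgVec r θ (σ ^ 2)).map (fun x i => x i / σ) = bgVec r θ 1 := by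
    unfold bgVec
    rw [Measure.pi_map_pi (hμ := fun i => by rw [bgLaw_map_div hσ]; infer_instance)
      (f := fun _ x => x / σ) (fun i => by fun_prop), bgLaw_map_div hσ]
  have hV1 := isProbabilityMeasure_bgVec r 1 h0 h1
  have hV := isProbabilityMeasure_bgVec r (σ ^ 2) h0 h1
  have hscale2 : (Measure.pi fun _ : Fin n => bgVec r θ (σ ^ 2)).map (fun x k i => x k i / σ)
      = Measure.pi fun _ : Fin n => bgVec r θ 1 := by
    rw [Measure.pi_map_pi (hμ := fun i => by rw [hscale]; infer_instance)
      (μ := fun _ : Fin n => bgVec r θ (σ ^ 2))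
      (f := fun _ (x : Fin r → ℝ) i => x i / σ) (fun i => Measurable.aemeasurable (by fun_prop)),
      hscale]
  rw [← hscale2]
  unfold bgVec
  rw [← pi_map_flip, Measure.map_map (by fun_prop) (by fun_prop)]
  rfl

/-! ### Bernstein's inequality for bounded i.i.d. variables -/

lemma exp_le_one_add_add_sq {u : ℝ} (hu : |u| ≤ 1) : rexp u ≤ 1 + u + u ^ 2 := by
  have := (abs_le.1 (Real.abs_exp_sub_one_sub_id_le hu)).2
  linarith

lemma bernstein_upper {E : Type*} [MeasurableSpace E] (ν : Measure E) [IsProbabilityMeasure ν]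
    {W : E → ℝ} (hW : Measurable W) {B v L : ℝ} (hB : 0 < B) (hv : 0 < v) (hL : 0 < L)
    (hWB : ∀ x, |W x| ≤ B) (hWv : ∫ x, W x ^ 2 ∂ν ≤ v) {n : ℕ} (hn : 1 ≤ n) :
    (Measure.pi fun _ : Fin n => ν).real
      {x | n * ∫ y, W y ∂ν + n * (2 * √(v * L / n) + 2 * (B * L / n)) ≤ ∑ k, W (x k)}
      ≤ rexp (-L) := by
  have hn' : (0 : ℝ) < n := by exact_mod_cast hn
  set a := √(v * L / n) with ha
  have ha2 : a ^ 2 = v * L / n := Real.sq_sqrt (by positivity)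
  have ha0 : 0 < a := Real.sqrt_pos.2 (by positivity)
  have hiW : Integrable W ν := Integrable.of_bound hW.aestronglyMeasurable B
    (ae_of_all _ hWB)
  have hiW2 : Integrable (fun x => W x ^ 2) ν :=
    Integrable.of_bound (by fun_prop) (B ^ 2) (ae_of_all _ fun x => by
      rw [Real.norm_eq_abs, abs_pow]; exact pow_le_pow_left₀ (abs_nonneg _) (hWB x) 2)
  have main : ∀ l : ℝ, 0 ≤ l → l * B ≤ 1 →
      (Measure.pi fun _ : Fin n => ν).real
      {x | n * ∫ y, W y ∂ν + n * (2 * a + 2 * (B * L / n)) ≤ ∑ k, W (x k)}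
      ≤ rexp (n * (l ^ 2 * v) - n * l * (2 * a + 2 * (B * L / n))) := by
    intro l hl hlB
    have hlW : ∀ x, |l * W x| ≤ 1 := fun x => by
      rw [abs_mul, abs_of_nonneg hl]
      exact (mul_le_mul_of_nonneg_left (hWB x) hl).trans hlB
    have hiE : Integrable (fun x => rexp (l * W x)) ν :=
      Integrable.of_bound (by fun_prop) (rexp 1) (ae_of_all _ fun x => by
        rw [Real.norm_eq_abs, Real.abs_exp]
        exact Real.exp_le_exp.2 ((le_abs_self _).trans (hlW x)))
    have hmgf1 : mgf W ν l ≤ rexp (l * ∫ y, W y ∂ν + l ^ 2 * v) := by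
      have hb : ∫ x, rexp (l * W x) ∂ν ≤ ∫ x, ((1 + l * W x) + l ^ 2 * W x ^ 2) ∂ν := by
        refine integral_mono hiE (((integrable_const 1).fun_add (hiW.const_mul l)).fun_add
          (hiW2.const_mul _)) fun x => ?_
        have := exp_le_one_add_add_sq (hlW x)
        simp only
        linarith [mul_pow l (W x) 2]
      rw [integral_add ((integrable_const 1).fun_add (hiW.const_mul l)) (hiW2.const_mul _),
        integral_add (integrable_const 1) (hiW.const_mul l), integral_const_mul,
        integral_const_mul] at hb
      simp only [integral_const, probReal_univ, smul_eq_mul, mul_one] at hb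
      rw [mgf]
      have h3 := Real.add_one_le_exp (l * ∫ y, W y ∂ν + l ^ 2 * v)
      have h4 := mul_le_mul_of_nonneg_left hWv (sq_nonneg l)
      linarith
    have hind : iIndepFun (fun k (x : Fin n → E) => W (x k)) (Measure.pi fun _ : Fin n => ν) :=
      iIndepFun_pi (X := fun _ => W) fun i => hW.aemeasurable
    have hmeas : ∀ k : Fin n, Measurable fun x : Fin n → E => W (x k) :=
      fun k => hW.comp (measurable_pi_apply k)
    have hmgf : mgf (∑ k, fun x : Fin n → E => W (x k)) (Measure.pi fun _ : Fin n => ν) l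
        ≤ rexp (n * (l * ∫ y, W y ∂ν + l ^ 2 * v)) := by
      rw [hind.mgf_sum hmeas]
      have : ∀ k : Fin n, mgf (fun x : Fin n → E => W (x k)) (Measure.pi fun _ : Fin n => ν) l
          = mgf W ν l := fun k => by
        rw [mgf, mgf, integral_comp_eval (μ := fun _ : Fin n => ν)
          (f := fun y => rexp (l * W y)) hiE.1]
      rw [Finset.prod_congr rfl fun k _ => this k, Finset.prod_const, Finset.card_univ,
        Fintype.card_fin, Real.exp_nat_mul]
      exact pow_le_pow_left₀ mgf_nonneg hmgf1 n
    have hiS : Integrable (fun x : Fin n → E => rexp (l * (∑ k, fun x : Fin n → E => W (x k)) x))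
        (Measure.pi fun _ : Fin n => ν) := by
      simp only [Finset.sum_apply, Finset.mul_sum, Real.exp_sum]
      exact Integrable.fintype_prod (f := fun _ y => rexp (l * W y)) fun _ => hiE
    have hch := measure_ge_le_exp_mul_mgf (X := ∑ k, fun x : Fin n → E => W (x k))
      (n * ∫ y, W y ∂ν + n * (2 * a + 2 * (B * L / n))) hl hiS
    simp only [Finset.sum_apply] at hch
    refine hch.trans ?_
    calc _ ≤ rexp (-l * (n * ∫ y, W y ∂ν + n * (2 * a + 2 * (B * L / n))))
          * rexp (n * (l * ∫ y, W y ∂ν + l ^ 2 * v)) := by gcongr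
      _ = _ := by rw [← Real.exp_add]; congr 1; ring
  have hBL : n * (B * L / n) = B * L := by field_simp
  have hvL : n * a ^ 2 = v * L := by rw [ha2]; field_simp
  rcases le_total (a * B) v with hc | hc
  · -- the unconstrained optimum `a / v` is admissible
    refine (main (a / v) (by positivity) (by rw [div_mul_eq_mul_div, div_le_one hv]; exact hc)).trans
      (Real.exp_le_exp.2 ?_)
    have e1 : (n : ℝ) * ((a / v) ^ 2 * v) = L := by
      have : (n : ℝ) * ((a / v) ^ 2 * v) = (n * a ^ 2) / v := by field_simp
      rw [this, hvL]; field_simp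
    have e2 : (n : ℝ) * (a / v) * (2 * a + 2 * (B * L / n)) = 2 * L + 2 * (a / v) * (B * L) := by
      have : (n : ℝ) * (a / v) * (2 * a + 2 * (B * L / n))
        = 2 * ((n * a ^ 2) / v) + 2 * (a / v) * (n * (B * L / n)) := by ring
      rw [this, hvL, hBL]; field_simp
    have : 0 ≤ 2 * (a / v) * (B * L) := by positivity
    rw [e1, e2]; linarith
  · refine (main (1 / B) (by positivity) (by field_simp; rfl)).trans (Real.exp_le_exp.2 ?_)
    have e1 : (n : ℝ) * ((1 / B) ^ 2 * v) ≤ n * (1 / B) * (2 * a) := by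
      have h5 : (1 / B) * v ≤ a := by
        rw [one_div_mul_eq_div, div_le_iff₀ hB]; exact hc
      have : (1 / B) ^ 2 * v ≤ (1 / B) * (2 * a) := by
        have : (1 / B) ^ 2 * v = (1 / B) * ((1 / B) * v) := by ring
        rw [this]
        exact mul_le_mul_of_nonneg_left (by linarith) (by positivity)
      calc (n : ℝ) * ((1 / B) ^ 2 * v) ≤ n * ((1 / B) * (2 * a)) := by gcongr
        _ = _ := by ring
    have e2 : (n : ℝ) * (1 / B) * (2 * (B * L / n)) = 2 * L := by field_simp
    rw [mul_add, e2]; linarith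

lemma bernstein_two_sided {E : Type*} [MeasurableSpace E] (ν : Measure E) [IsProbabilityMeasure ν]
    {W : E → ℝ} (hW : Measurable W) {B v L : ℝ} (hB : 0 < B) (hv : 0 < v) (hL : 0 < L)
    (hWB : ∀ x, |W x| ≤ B) (hWv : ∫ x, W x ^ 2 ∂ν ≤ v) {n : ℕ} (hn : 1 ≤ n) :
    (Measure.pi fun _ : Fin n => ν).real
      {x | n * (2 * √(v * L / n) + 2 * (B * L / n)) ≤ |∑ k, W (x k) - n * ∫ y, W y ∂ν|}
      ≤ 2 * rexp (-L) := by
  have h1 := bernstein_upper ν hW hB hv hL hWB hWv hn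
  have h2 := bernstein_upper ν hW.neg hB hv hL (fun x => by simpa using hWB x)
    (by simpa using hWv) hn
  refine le_trans ?_ ((measureReal_union_le _ _).trans
    ((add_le_add h1 h2).trans_eq (by ring)))
  refine measureReal_mono ?_ (measure_ne_top _ _)
  intro x hx
  simp only [Set.mem_ofPred_eq, Set.mem_union, Pi.neg_apply, integral_neg,
    Finset.sum_neg_distrib] at hx ⊢
  rcases le_abs.1 hx with h | h
  · left; linarith
  · right; linarith

/-! ### Discretization of the unit ball -/

lemma exists_int_div_near {N : ℕ} (hN : 1 ≤ N) {t : ℝ} (ht : t ^ 2 ≤ 1) :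
    ∃ a ∈ Finset.Icc (-(N : ℤ)) N,
      ((a : ℝ) / N) ^ 2 ≤ t ^ 2 ∧ (t - (a : ℝ) / N) ^ 2 ≤ 1 / (N : ℝ) ^ 2 := by
  have hN' : (0 : ℝ) < N := by exact_mod_cast hN
  have nonneg_case : ∀ t : ℝ, 0 ≤ t → t ≤ 1 → ∃ a ∈ Finset.Icc (-(N : ℤ)) N,
      ((a : ℝ) / N) ^ 2 ≤ t ^ 2 ∧ (t - (a : ℝ) / N) ^ 2 ≤ 1 / (N : ℝ) ^ 2 := by
    intro t h0 h1
    have hf0 : 0 ≤ ⌊N * t⌋ := Int.floor_nonneg.2 (by positivity)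
    have hf1 : (⌊N * t⌋ : ℝ) ≤ N * t := Int.floor_le _
    have hf2 : N * t < ⌊N * t⌋ + 1 := Int.lt_floor_add_one _
    have hfN : ⌊N * t⌋ ≤ (N : ℤ) := by
      have : (⌊N * t⌋ : ℝ) ≤ (N : ℤ) := by push_cast; nlinarith
      exact_mod_cast this
    have hf0' : (0 : ℝ) ≤ ⌊N * t⌋ := by exact_mod_cast hf0
    refine ⟨⌊N * t⌋, Finset.mem_Icc.2 ⟨by omega, hfN⟩, ?_, ?_⟩
    · gcongr
      rw [div_le_iff₀ hN']; linarith
    · have : t - (⌊N * t⌋ : ℝ) / N = (N * t - ⌊N * t⌋) / N := by field_simp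
      rw [this, div_pow]
      gcongr
      nlinarith
  have habs : |t| ≤ 1 := by rwa [← sq_le_one_iff_abs_le_one]
  rcases le_total 0 t with h | h
  · exact nonneg_case t h (by rwa [abs_of_nonneg h] at habs)
  · obtain ⟨a, ha, h1, h2⟩ := nonneg_case (-t) (by linarith) (by rwa [abs_of_nonpos h] at habs)
    rw [Finset.mem_Icc] at ha
    refine ⟨-a, Finset.mem_Icc.2 ⟨by omega, by omega⟩, ?_, ?_⟩
    · push_cast; rw [neg_div, neg_sq]; simpa using h1
    · push_cast
      refine le_of_eq_of_le ?_ h2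
      ring

lemma exists_finset_near_unit_ball (r : ℕ) {N : ℕ} (hN : 1 ≤ N) :
    ∃ S : Finset (Fin r → ℝ), S.card ≤ (2 * N + 1) ^ r ∧ (∀ z ∈ S, l2sq z ≤ 1) ∧
      ∀ ζ : Fin r → ℝ, l2sq ζ ≤ 1 → ∃ z ∈ S, l2sq (ζ - z) ≤ r / (N : ℝ) ^ 2 := by
  classical
  refine ⟨(Fintype.piFinset fun _ : Fin r =>
    (Finset.Icc (-(N : ℤ)) N).image fun a : ℤ => (a : ℝ) / N).filter fun z => l2sq z ≤ 1, ?_, ?_, ?_⟩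
  · refine (Finset.card_filter_le _ _).trans ?_
    rw [Fintype.card_piFinset, Finset.prod_const, Finset.card_univ, Fintype.card_fin]
    refine Nat.pow_le_pow_left (Finset.card_image_le.trans ?_) r
    rw [Int.card_Icc]; omega
  · intro z hz; exact (Finset.mem_filter.1 hz).2
  · intro ζ hζ
    have hi : ∀ i, ζ i ^ 2 ≤ 1 := fun i => (Finset.single_le_sum (f := fun i => ζ i ^ 2)
      (fun i _ => sq_nonneg _) (Finset.mem_univ i)).trans hζ
    choose a ha h1 h2 using fun i => exists_int_div_near hN (hi i)
    refine ⟨fun i => (a i : ℝ) / N, Finset.mem_filter.2 ⟨?_, ?_⟩, ?_⟩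
    · rw [Fintype.mem_piFinset]
      exact fun i => Finset.mem_image_of_mem _ (ha i)
    · exact (Finset.sum_le_sum fun i _ => h1 i).trans hζ
    · refine (Finset.sum_le_sum fun i _ => h2 i).trans_eq ?_
      simp [div_eq_mul_inv]

/-! ### The truncated quartic form -/

/-- The normalized quartic form, set to zero when `‖x‖² ≥ T`. -/
def truncQuartic {r : ℕ} (θ T : ℝ) (ζ x : Fin r → ℝ) : ℝ :=
  if l2sq x < T then (ζ ⬝ᵥ x) ^ 4 / θ else 0

lemma measurable_l2sq {r : ℕ} : Measurable (l2sq : (Fin r → ℝ) → ℝ) := by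
  unfold l2sq; fun_prop

lemma measurable_truncQuartic {r : ℕ} (θ T : ℝ) (ζ : Fin r → ℝ) :
    Measurable (truncQuartic θ T ζ) :=
  Measurable.ite (measurableSet_lt measurable_l2sq measurable_const)
    (by unfold dotProduct; fun_prop) measurable_const

lemma sq_dotProduct_le {r : ℕ} (ζ x : Fin r → ℝ) : (ζ ⬝ᵥ x) ^ 2 ≤ l2sq ζ * l2sq x :=
  Finset.sum_mul_sq_le_sq_mul_sq _ _ _

lemma l2sq_nonneg_s14 {r : ℕ} (x : Fin r → ℝ) : 0 ≤ l2sq x :=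
  Finset.sum_nonneg fun _ _ => sq_nonneg _

lemma sq_dotProduct_le_of_lt {r : ℕ} {T : ℝ} {ζ x : Fin r → ℝ} (hζ : l2sq ζ ≤ 1)
    (hx : l2sq x < T) : (ζ ⬝ᵥ x) ^ 2 ≤ T := by
  have h1 := sq_dotProduct_le ζ x
  have h2 := l2sq_nonneg_s14 x
  nlinarith

lemma abs_truncQuartic_le {r : ℕ} {θ T : ℝ} (hθ : 0 < θ) {ζ : Fin r → ℝ}
    (hζ : l2sq ζ ≤ 1) (x : Fin r → ℝ) : |truncQuartic θ T ζ x| ≤ T ^ 2 / θ := by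
  unfold truncQuartic
  split_ifs with h
  · rw [abs_of_nonneg (by positivity)]
    gcongr
    have h1 := sq_dotProduct_le_of_lt hζ h
    calc (ζ ⬝ᵥ x) ^ 4 = ((ζ ⬝ᵥ x) ^ 2) ^ 2 := by ring
      _ ≤ T ^ 2 := by gcongr
  · rw [abs_zero]; positivity

lemma integral_truncQuartic_sq_le {r : ℕ} {θ T : ℝ} (hθ : 0 < θ) (h1 : θ ≤ 1) {ζ : Fin r → ℝ}
    (hζ : l2sq ζ ≤ 1) : ∫ x, truncQuartic θ T ζ x ^ 2 ∂(bgVec r θ 1) ≤ 80640 / θ := by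
  calc ∫ x, truncQuartic θ T ζ x ^ 2 ∂(bgVec r θ 1)
      ≤ ∫ x, (ζ ⬝ᵥ x) ^ 8 / θ ^ 2 ∂(bgVec r θ 1) := by
        refine integral_mono_of_nonneg (ae_of_all _ fun x => sq_nonneg _)
          ((integrable_dotProduct_pow_bgVec hθ.le h1 ζ 8).div_const _) (ae_of_all _ fun x => ?_)
        simp only [truncQuartic]
        split_ifs
        · rw [div_pow, ← pow_mul]
        · have : 0 ≤ (ζ ⬝ᵥ x) ^ 8 / θ ^ 2 := by positivity
          simpa using this
    _ = (∫ x, (ζ ⬝ᵥ x) ^ 8 ∂(bgVec r θ 1)) / θ ^ 2 := integral_div _ _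
    _ ≤ 80640 * θ / θ ^ 2 := by
        gcongr; exact integral_dotProduct_pow_eight_le hθ.le h1 ζ hζ
    _ = 80640 / θ := by field_simp

lemma abs_truncQuartic_sub_le {r : ℕ} {θ T δ : ℝ} (hθ : 0 < θ) (hδ : 0 ≤ δ)
    {ζ z : Fin r → ℝ} (hζ : l2sq ζ ≤ 1) (hz : l2sq z ≤ 1) (hd : l2sq (ζ - z) ≤ δ ^ 2)
    (x : Fin r → ℝ) :
    |truncQuartic θ T ζ x - truncQuartic θ T z x| ≤ 4 * δ * (T ^ 2 / θ) := by
  unfold truncQuartic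
  split_ifs with h
  · have hT : 0 ≤ T := (l2sq_nonneg_s14 x).trans h.le
    have ha := sq_dotProduct_le_of_lt hζ h
    have hb := sq_dotProduct_le_of_lt hz h
    have hab : (ζ ⬝ᵥ x - z ⬝ᵥ x) ^ 2 ≤ δ ^ 2 * T := by
      rw [← sub_dotProduct]
      refine (sq_dotProduct_le _ _).trans ?_
      have := l2sq_nonneg_s14 x
      have := l2sq_nonneg_s14 (ζ - z)
      gcongr
    set a := ζ ⬝ᵥ x
    set b := z ⬝ᵥ x
    have ha' : |a| ≤ √T := Real.abs_le_sqrt ha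
    have hb' : |b| ≤ √T := Real.abs_le_sqrt hb
    have hab' : |a - b| ≤ δ * √T := by
      have := Real.abs_le_sqrt hab
      rwa [Real.sqrt_mul (sq_nonneg δ), Real.sqrt_sq hδ] at this
    have hs := Real.sq_sqrt hT
    have e : a ^ 4 / θ - b ^ 4 / θ = (a - b) * (a + b) * (a ^ 2 + b ^ 2) / θ := by ring
    rw [e, abs_div, abs_of_pos hθ, abs_mul, abs_mul, abs_of_nonneg (by positivity : 0 ≤ a ^ 2 + b ^ 2),
      ← mul_div_assoc]
    refine div_le_div_of_nonneg_right ?_ hθ.le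
    have hp : |a + b| ≤ 2 * √T := (abs_add_le a b).trans (by linarith)
    calc |a - b| * |a + b| * (a ^ 2 + b ^ 2) ≤ (δ * √T) * (2 * √T) * (T + T) := by gcongr
      _ = 4 * δ * (√T ^ 2) * T := by ring
      _ = 4 * δ * T ^ 2 := by rw [hs]; ring
  · simp; positivity

lemma integrable_truncQuartic {r : ℕ} {θ T : ℝ} (hθ : 0 < θ) (h1 : θ ≤ 1) {ζ : Fin r → ℝ}
    (hζ : l2sq ζ ≤ 1) : Integrable (truncQuartic θ T ζ) (bgVec r θ 1) := by
  have := isProbabilityMeasure_bgVec r 1 hθ.le h1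
  exact Integrable.of_bound (measurable_truncQuartic θ T ζ).aestronglyMeasurable (T ^ 2 / θ)
    (ae_of_all _ (abs_truncQuartic_le hθ hζ))

lemma abs_integral_truncQuartic_sub_le {r : ℕ} {θ T s : ℝ} (hθ : 0 < θ) (h1 : θ ≤ 1) (hs : 0 < s)
    {ζ : Fin r → ℝ} (hζ : l2sq ζ ≤ 1) :
    |∫ x, truncQuartic θ T ζ x ∂(bgVec r θ 1) - 3 * ((1 - θ) * l4p4 ζ + θ * l2sq ζ ^ 2)|
      ≤ s * (80640 / θ) + (bgVec r θ 1).real {x | T ≤ l2sq x} / s := by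
  have := isProbabilityMeasure_bgVec r 1 hθ.le h1
  have i4 := (integrable_dotProduct_pow_bgVec hθ.le h1 ζ 4).div_const θ
  have i8 := (integrable_dotProduct_pow_bgVec hθ.le h1 ζ 8).div_const (θ ^ 2)
  have hmean : 3 * ((1 - θ) * l4p4 ζ + θ * l2sq ζ ^ 2)
      = ∫ x, (ζ ⬝ᵥ x) ^ 4 / θ ∂(bgVec r θ 1) := by
    rw [integral_div, integral_dotProduct_pow_four hθ.le h1]; field_simp
  have hset : MeasurableSet {x : Fin r → ℝ | T ≤ l2sq x} :=
    measurableSet_le measurable_const measurable_l2sq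
  have hind : Integrable (fun x => ({x : Fin r → ℝ | T ≤ l2sq x}.indicator 1 x : ℝ) / s)
      (bgVec r θ 1) := ((integrable_const (1 : ℝ)).indicator hset).div_const s
  rw [hmean, ← integral_sub (integrable_truncQuartic hθ h1 hζ) i4]
  calc _ ≤ ∫ x, (s * ((ζ ⬝ᵥ x) ^ 8 / θ ^ 2)
          + ({x : Fin r → ℝ | T ≤ l2sq x}.indicator 1 x : ℝ) / s) ∂(bgVec r θ 1) := by
        rw [← Real.norm_eq_abs]
        refine norm_integral_le_of_norm_le ((i8.const_mul s).fun_add hind) (ae_of_all _ fun x => ?_)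
        rw [Real.norm_eq_abs]
        by_cases h : l2sq x < T
        · simp [truncQuartic, h]
          positivity
        · have hm : x ∈ {x : Fin r → ℝ | T ≤ l2sq x} := not_lt.1 h
          rw [Set.indicator_of_mem hm, Pi.one_apply]
          simp only [truncQuartic, h, if_false, zero_sub, abs_neg]
          set u := (ζ ⬝ᵥ x) ^ 4 / θ with hu
          have hu8 : (ζ ⬝ᵥ x) ^ 8 / θ ^ 2 = u ^ 2 := by rw [hu, div_pow, ← pow_mul]
          have hu0 : 0 ≤ u := by positivity
          rw [hu8, abs_of_nonneg hu0]
          have : s * u ^ 2 + 1 / s - u = ((s * u - 1 / 2) ^ 2 + 3 / 4) / s := by field_simp; ring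
          have h2 : 0 ≤ ((s * u - 1 / 2) ^ 2 + 3 / 4) / s := by positivity
          linarith
    _ = s * ((∫ x, (ζ ⬝ᵥ x) ^ 8 ∂(bgVec r θ 1)) / θ ^ 2)
          + (bgVec r θ 1).real {x | T ≤ l2sq x} / s := by
        rw [integral_add (i8.const_mul s) hind, integral_const_mul, integral_div, integral_div,
          integral_indicator_one hset]
    _ ≤ _ := by
        refine add_le_add_left (mul_le_mul_of_nonneg_left ?_ hs.le) _
        calc _ ≤ 80640 * θ / θ ^ 2 := by
              gcongr; exact integral_dotProduct_pow_eight_le hθ.le h1 ζ hζ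
          _ = 80640 / θ := by field_simp

/-! ### Uniform deviation of the empirical quartic form -/

lemma uniform_deviation_of_net {r n : ℕ} (hn : 1 ≤ n) {θ T t D : ℝ}
    (hθ : 0 < θ) (h1 : θ ≤ 1) {S : Finset (Fin r → ℝ)} (hS : ∀ z ∈ S, l2sq z ≤ 1)
    (hnet : ∀ ζ : Fin r → ℝ, l2sq ζ ≤ 1 → ∃ z ∈ S, l2sq (ζ - z) ≤ (1 / (n : ℝ)) ^ 2)
    (hD : ∀ ζ : Fin r → ℝ, l2sq ζ ≤ 1 →
      |∫ x, truncQuartic θ T ζ x ∂(bgVec r θ 1) - 3 * ((1 - θ) * l4p4 ζ + θ * l2sq ζ ^ 2)| ≤ D)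
    {x : Fin n → Fin r → ℝ} (hx : ∀ k, l2sq (x k) < T)
    (hz : ∀ z ∈ S, |∑ k, truncQuartic θ T z (x k)
      - n * ∫ y, truncQuartic θ T z y ∂(bgVec r θ 1)| ≤ n * t)
    {ζ : Fin r → ℝ} (hζ : l2sq ζ ≤ 1) :
    |(∑ k, (ζ ⬝ᵥ x k) ^ 4 / θ) / n - 3 * ((1 - θ) * l4p4 ζ + θ * l2sq ζ ^ 2)|
      ≤ 8 * (T ^ 2 / θ / n) + t + D := by
  have := isProbabilityMeasure_bgVec r 1 hθ.le h1
  have hn' : (0 : ℝ) < n := by exact_mod_cast hn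
  obtain ⟨z, hzS, hd⟩ := hnet ζ hζ
  have hdiff := abs_truncQuartic_sub_le (T := T) hθ (by positivity) hζ (hS z hzS) hd
  have hsum : ∑ k, (ζ ⬝ᵥ x k) ^ 4 / θ = ∑ k, truncQuartic θ T ζ (x k) :=
    Finset.sum_congr rfl fun k _ => by simp [truncQuartic, hx k]
  have e1 : |∑ k, truncQuartic θ T ζ (x k) - ∑ k, truncQuartic θ T z (x k)|
      ≤ n * (4 * (1 / (n : ℝ)) * (T ^ 2 / θ)) := by
    rw [← Finset.sum_sub_distrib]
    refine (Finset.abs_sum_le_sum_abs _ _).trans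
      ((Finset.sum_le_sum fun k _ => hdiff (x k)).trans_eq ?_)
    simp
  have e2 : |∫ y, truncQuartic θ T ζ y ∂(bgVec r θ 1) - ∫ y, truncQuartic θ T z y ∂(bgVec r θ 1)|
      ≤ 4 * (1 / (n : ℝ)) * (T ^ 2 / θ) := by
    rw [← integral_sub (integrable_truncQuartic hθ h1 hζ)
      (integrable_truncQuartic hθ h1 (hS z hzS)), ← Real.norm_eq_abs]
    refine (norm_integral_le_of_norm_le_const (ae_of_all _ hdiff)).trans_eq ?_
    simp
  have e3 := hz z hzS
  have e4 := hD ζ hζ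
  rw [hsum]
  set s1 := ∑ k, truncQuartic θ T ζ (x k)
  set s2 := ∑ k, truncQuartic θ T z (x k)
  set m1 := ∫ y, truncQuartic θ T ζ y ∂(bgVec r θ 1)
  set m2 := ∫ y, truncQuartic θ T z y ∂(bgVec r θ 1)
  have e13 : |s1 / n - m2| ≤ 4 * (1 / (n : ℝ)) * (T ^ 2 / θ) + t := by
    have : s1 / n - m2 = ((s1 - s2) + (s2 - n * m2)) / n := by field_simp; ring
    rw [this, abs_div, abs_of_pos hn', div_le_iff₀ hn']
    refine (abs_add_le _ _).trans ((add_le_add e1 e3).trans_eq ?_)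
    ring
  have e8 : 8 * (T ^ 2 / θ / n) = 2 * (4 * (1 / (n : ℝ)) * (T ^ 2 / θ)) := by ring
  rw [e8]
  rw [abs_le] at *
  constructor <;> linarith [e13.1, e13.2, e2.1, e2.2, e4.1, e4.2]

lemma measureReal_deviation_le {r n : ℕ} (hr : 1 ≤ r) (hn : 2 ≤ n) {θ M : ℝ} (hθ : 0 < θ)
    (h1 : θ ≤ 1) (hM : 2 * (n * r : ℕ) + 1 ≤ M) (hMe : 1 ≤ Real.log M) :
    (Measure.pi fun _ : Fin n => bgVec r θ 1).real
      {x | ¬ ∀ ζ : Fin r → ℝ, l2sq ζ ≤ 1 →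
        |(∑ k, (ζ ⬝ᵥ x k) ^ 4 / θ) / n - 3 * ((1 - θ) * l4p4 ζ + θ * l2sq ζ ^ 2)|
        ≤ 100000 * √(r * Real.log M / (θ * n))
          + 12 * ((4 * θ * r + 8 * Real.log n) ^ 2 / θ * (r * Real.log M / n))}
      ≤ 3 / n := by
  have hV := isProbabilityMeasure_bgVec r 1 hθ.le h1
  have hn' : (2 : ℝ) ≤ n := by exact_mod_cast hn
  have hn0 : (0 : ℝ) < n := by linarith
  have hr' : (1 : ℝ) ≤ r := by exact_mod_cast hr
  have hN : 1 ≤ n * r := Nat.one_le_iff_ne_zero.2 (by positivity)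
  have hnr : (n : ℝ) ≤ (n * r : ℕ) := by push_cast; nlinarith
  have hM0 : 0 < M := by linarith
  have hnM : (n : ℝ) ≤ M := by linarith
  set T := 4 * θ * r + 8 * Real.log n with hT
  have hT0 : 0 < T := by
    have := Real.log_nonneg (by linarith : (1 : ℝ) ≤ n)
    positivity
  set B := T ^ 2 / θ with hB
  have hB0 : 0 < B := by positivity
  set ℓ := r * Real.log M with hℓ
  have hℓ1 : 1 ≤ ℓ := by nlinarith
  set t := 2 * √(80640 / θ * (2 * ℓ) / n) + 2 * (B * (2 * ℓ) / n) with ht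
  obtain ⟨S, hcard, hS, hnet⟩ := exists_finset_near_unit_ball r hN
  have hnet' : ∀ ζ : Fin r → ℝ, l2sq ζ ≤ 1 → ∃ z ∈ S, l2sq (ζ - z) ≤ (1 / (n : ℝ)) ^ 2 := by
    intro ζ hζ
    obtain ⟨z, hz, hd⟩ := hnet ζ hζ
    refine ⟨z, hz, hd.trans ?_⟩
    push_cast
    rw [div_pow, one_pow, div_le_div_iff₀ (by positivity) (by positivity)]
    have : (0 : ℝ) < n ^ 2 := by positivity
    nlinarith
  set Q := √(ℓ / (θ * n)) with hQ
  set Q0 := √(1 / (θ * n)) with hQ0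
  have hQ0pos : 0 < Q0 := Real.sqrt_pos.2 (by positivity)
  have hQ0Q : Q0 ≤ Q := Real.sqrt_le_sqrt (by gcongr)
  have hD : ∀ ζ : Fin r → ℝ, l2sq ζ ≤ 1 →
      |∫ x, truncQuartic θ T ζ x ∂(bgVec r θ 1) - 3 * ((1 - θ) * l4p4 ζ + θ * l2sq ζ ^ 2)|
        ≤ 80641 * Q := by
    intro ζ hζ
    refine (abs_integral_truncQuartic_sub_le (T := T) (s := θ * Q0) hθ h1 (by positivity) hζ).trans ?_
    have hsq : Q0 ^ 2 = 1 / (θ * n) := Real.sq_sqrt (by positivity)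
    have a1 : θ * Q0 * (80640 / θ) = 80640 * Q0 := by field_simp
    have a2 : (bgVec r θ 1).real {x | T ≤ l2sq x} / (θ * Q0) ≤ Q0 := by
      rw [div_le_iff₀ (by positivity)]
      refine (bgVec_l2sq_tail r n hθ.le h1 (by omega)).trans ?_
      have : Q0 * (θ * Q0) = (n : ℝ)⁻¹ := by
        calc Q0 * (θ * Q0) = θ * Q0 ^ 2 := by ring
          _ = _ := by rw [hsq]; field_simp
      rw [this]
      gcongr
      nlinarith
    linarith
  have htQ : t ≤ 806 * Q + 4 * (B * (ℓ / n)) := by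
    have b1 : √(80640 / θ * (2 * ℓ) / n) ≤ 403 * Q := by
      rw [Real.sqrt_le_left (by positivity), mul_pow, hQ, Real.sq_sqrt (by positivity)]
      have : 80640 / θ * (2 * ℓ) / n = 161280 * (ℓ / (θ * n)) := by field_simp; norm_num
      rw [this]
      gcongr
      norm_num
    have b2 : B * (2 * ℓ) / n = 2 * (B * (ℓ / n)) := by ring
    rw [ht, b2]; linarith
  have hBn : B / n ≤ B * (ℓ / n) := by
    rw [div_eq_mul_inv, div_eq_mul_inv]
    have : 0 < (n : ℝ)⁻¹ := by positivity
    gcongr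
    nlinarith
  have htail : ∀ k : Fin n, (Measure.pi fun _ : Fin n => bgVec r θ 1).real
      {x | T ≤ l2sq (x k)} ≤ ((n : ℝ) ^ 2)⁻¹ := by
    intro k
    refine le_of_eq_of_le ?_ (bgVec_l2sq_tail r n hθ.le h1 (by omega))
    exact (measurePreserving_eval (fun _ : Fin n => bgVec r θ 1) k).measureReal_preimage
      (measurableSet_le measurable_const measurable_l2sq).nullMeasurableSet
  have hbern : ∀ z ∈ S, (Measure.pi fun _ : Fin n => bgVec r θ 1).real
      {x | n * t ≤ |∑ k, truncQuartic θ T z (x k)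
        - n * ∫ y, truncQuartic θ T z y ∂(bgVec r θ 1)|} ≤ 2 * rexp (-(2 * ℓ)) := fun z hz =>
    bernstein_two_sided (bgVec r θ 1) (measurable_truncQuartic θ T z) hB0 (by positivity)
      (by positivity) (abs_truncQuartic_le hθ (hS z hz))
      (integral_truncQuartic_sq_le hθ h1 (hS z hz)) (by omega)
  have hsub : {x : Fin n → Fin r → ℝ | ¬ ∀ ζ : Fin r → ℝ, l2sq ζ ≤ 1 →
        |(∑ k, (ζ ⬝ᵥ x k) ^ 4 / θ) / n - 3 * ((1 - θ) * l4p4 ζ + θ * l2sq ζ ^ 2)|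
        ≤ 100000 * Q + 12 * (B * (ℓ / n))}
      ⊆ (⋃ k ∈ (Finset.univ : Finset (Fin n)), {x | T ≤ l2sq (x k)}) ∪
        ⋃ z ∈ S, {x | n * t ≤ |∑ k, truncQuartic θ T z (x k)
          - n * ∫ y, truncQuartic θ T z y ∂(bgVec r θ 1)|} := by
    intro x hx
    by_contra hc
    simp only [Set.mem_union, Set.mem_iUnion, Set.mem_ofPred_eq, not_or, not_exists, not_le,
      Finset.mem_univ, exists_prop, true_and, not_and] at hc
    refine hx fun ζ hζ => (uniform_deviation_of_net (by omega) hθ h1 hS hnet' hD hc.1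
      (fun z hz => (hc.2 z hz).le) hζ).trans ?_
    rw [← hB]
    linarith
  have hexp : rexp (-(2 * ℓ)) = (M ^ r)⁻¹ * (M ^ r)⁻¹ := by
    have : rexp ℓ = M ^ r := by rw [hℓ, Real.exp_nat_mul, Real.exp_log hM0]
    rw [two_mul, neg_add, Real.exp_add, Real.exp_neg, this]
  refine (measureReal_mono hsub (measure_ne_top _ _)).trans ((measureReal_union_le _ _).trans ?_)
  have c1 := (measureReal_biUnion_finset_le (μ := Measure.pi fun _ : Fin n => bgVec r θ 1)
    Finset.univ (fun k : Fin n => {x : Fin n → Fin r → ℝ | T ≤ l2sq (x k)})).trans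
    (Finset.sum_le_sum fun k _ => htail k)
  have c2 := (measureReal_biUnion_finset_le (μ := Measure.pi fun _ : Fin n => bgVec r θ 1)
    S (fun z => {x : Fin n → Fin r → ℝ | n * t ≤ |∑ k, truncQuartic θ T z (x k)
        - n * ∫ y, truncQuartic θ T z y ∂(bgVec r θ 1)|})).trans (Finset.sum_le_sum hbern)
  have c3 : ∑ _k : Fin n, ((n : ℝ) ^ 2)⁻¹ = 1 / n := by
    simp; field_simp
  have c4 : ∑ _z ∈ S, 2 * rexp (-(2 * ℓ)) ≤ 2 / n := by
    rw [Finset.sum_const, nsmul_eq_mul, hexp]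
    have hMr : (S.card : ℝ) ≤ M ^ r := by
      calc (S.card : ℝ) ≤ ((2 * (n * r) + 1) ^ r : ℕ) := by exact_mod_cast hcard
        _ = (2 * (n * r : ℕ) + 1 : ℝ) ^ r := by push_cast; ring
        _ ≤ M ^ r := by gcongr
    have hMn : (n : ℝ) ≤ M ^ r := hnM.trans (le_self_pow₀ (by linarith) (by omega))
    have hMr0 : 0 < M ^ r := by positivity
    calc (S.card : ℝ) * (2 * ((M ^ r)⁻¹ * (M ^ r)⁻¹))
        ≤ M ^ r * (2 * ((M ^ r)⁻¹ * (M ^ r)⁻¹)) := by gcongr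
      _ = 2 / M ^ r := by field_simp
      _ ≤ 2 / n := by gcongr
  rw [c3] at c1
  calc _ ≤ 1 / (n : ℝ) + 2 / n := add_le_add c1 (c2.trans c4)
    _ = 3 / n := by ring

lemma Ffun_sub_fpop {p r n : ℕ} {θ σ : ℝ} (hθ : 0 < θ) (hσ : 0 < σ) (A : Matrix (Fin p) (Fin r) ℝ)
    (X : Fin r → Fin n → ℝ) (q : Fin p → ℝ) :
    Ffun θ σ A (Matrix.of X) q - fpop θ A q = -(1 / 12) *
      ((∑ k, (zeta A q ⬝ᵥ fun i => X i k / σ) ^ 4 / θ) / n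
        - 3 * ((1 - θ) * l4p4 (zeta A q) + θ * l2sq (zeta A q) ^ 2)) := by
  have hdot : ∀ k, q ⬝ᵥ (A *ᵥ colX (Matrix.of X) k)
      = σ * (zeta A q ⬝ᵥ fun i => X i k / σ) := by
    intro k
    rw [dotProduct_mulVec, ← mulVec_transpose]
    simp only [dotProduct, Finset.mul_sum]
    refine Finset.sum_congr rfl fun i _ => ?_
    simp only [zeta, colX, Matrix.of_apply]
    field_simp
  unfold Ffun fpop
  simp_rw [hdot, mul_pow, ← Finset.mul_sum, ← Finset.sum_div]
  field_simp
  ring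

theorem stmt14 : ∃ C C' C'' c c' : ℝ,
    0 < C ∧ 0 < C' ∧ 0 < C'' ∧ 0 < c ∧ 0 < c' ∧
    ∀ (p r n : ℕ), 1 ≤ r → r ≤ p → 2 ≤ n →
    ∀ (θ σ : ℝ), 0 < θ → θ ≤ 1 → 0 < σ →
    ∀ (A : Matrix (Fin p) (Fin r) ℝ), Aᵀ * A = 1 →
    ∀ Mn : ℝ, Mn = C' * ((n:ℝ) + (r:ℝ)) * (θ * (r:ℝ)^2 + (Real.log (n:ℝ))^2/θ) →
      bgMatrix r n θ (σ^2) {X | ¬ ∀ q : Fin p → ℝ, l2sq q = 1 →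
        |Ffun θ σ A (Matrix.of X) q - fpop θ A q| ≤
          C'' * (Real.sqrt ((r:ℝ) * Real.log Mn / (θ * (n:ℝ)))
            + (Mn/(n:ℝ)) * ((r:ℝ) * Real.log Mn/(n:ℝ)))}
      ≤ ENNReal.ofReal (c * (n:ℝ) ^ (-c')) := by
  refine ⟨1, 128, 100000, 3, 1, by norm_num, by norm_num, by norm_num, by norm_num, by norm_num, ?_⟩
  intro p r n hr _ hn θ σ hθ h1 hσ A hA M hM
  have hV := isProbabilityMeasure_bgVec r 1 hθ.le h1
  have hn' : (2 : ℝ) ≤ n := by exact_mod_cast hn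
  have hr' : (1 : ℝ) ≤ r := by exact_mod_cast hr
  set lg := Real.log n with hlg
  have hlog : (1 / 2 : ℝ) ≤ lg := by
    have := Real.log_two_gt_d9
    have := Real.log_le_log (by norm_num) hn'
    linarith
  set b := θ * (r : ℝ) ^ 2 + lg ^ 2 / θ with hb
  have hbr : (r : ℝ) ≤ b := by
    have : b - 2 * r * lg = (θ * r - lg) ^ 2 / θ := by rw [hb]; field_simp; ring
    have : 0 ≤ (θ * r - lg) ^ 2 / θ := by positivity
    nlinarith
  have hM1 : 128 * ((n : ℝ) * r) ≤ M := by
    rw [hM]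
    calc 128 * ((n : ℝ) * r) ≤ 128 * ((n + r) * b) := by gcongr; linarith
      _ = _ := by ring
  have hnr : (2 : ℝ) ≤ (n : ℝ) * r := by nlinarith
  have hM2 : 2 * ((n * r : ℕ) : ℝ) + 1 ≤ M := by push_cast; linarith
  have hM0 : 0 < M := by linarith
  have hMe : 1 ≤ Real.log M := by
    rw [Real.le_log_iff_exp_le hM0]
    linarith [Real.exp_one_lt_d9]
  have hBM : (4 * θ * r + 8 * lg) ^ 2 / θ ≤ M / n := by
    have e1 : (4 * θ * r + 8 * lg) ^ 2 / θ ≤ 128 * b := by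
      have : 128 * b - (4 * θ * r + 8 * lg) ^ 2 / θ
          = (96 * (θ * r) ^ 2 + (4 * (θ * r) - 8 * lg) ^ 2) / θ := by
        rw [hb]; field_simp; ring
      have : 0 ≤ (96 * (θ * r) ^ 2 + (4 * (θ * r) - 8 * lg) ^ 2) / θ := by positivity
      linarith
    refine e1.trans ?_
    rw [le_div_iff₀ (by linarith), hM]
    nlinarith
  have hdev := measureReal_deviation_le hr hn hθ h1 hM2 hMe
  rw [← ENNReal.ofReal_le_ofReal_iff (by positivity), ofReal_measureReal,
    ← bgMatrix_map_transpose hθ.le h1 hσ] at hdev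
  have hc : (3 : ℝ) * (n : ℝ) ^ (-1 : ℝ) = 3 / n := by rw [Real.rpow_neg_one, div_eq_mul_inv]
  rw [hc]
  refine le_trans (measure_mono ?_)
    ((Measure.le_map_apply (Measurable.aemeasurable (by fun_prop)) _).trans hdev)
  intro X hX hgood
  refine hX fun q hq => ?_
  have h := hgood (zeta A q) ((l2sq_zeta_le hA q).trans hq.le)
  rw [Ffun_sub_fpop hθ hσ, abs_mul]
  have habs : |(-(1 / 12) : ℝ)| = 1 / 12 := by norm_num
  rw [habs]
  have hℓ : 0 ≤ r * Real.log M / (n : ℝ) := by positivity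
  have hfin := mul_le_mul_of_nonneg_right hBM hℓ
  have hsq := Real.sqrt_nonneg ((r:ℝ) * Real.log M / (θ * (n:ℝ)))
  have hpos : 0 ≤ M / (n : ℝ) * (r * Real.log M / n) := by positivity
  linarith

end
end
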